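/- arXiv:2004.10237 — 7 statements merged into one kernel-verified Lean document; each statement's English description precedes it below -/
import Mathlib

section
/- Let m ≥ 2 be an integer and let k be a field with char(k) = 0 or char(k) > 2m+1. Let S = k[x_1,…,x_{2m}] and let I be the ideal generated by x_1^2, …, x_{2m}^2 together with (x_1 + ⋯ + x_{2m})^2. Then for every natural number i, the k-dimension of the degree-i graded component of S/I equals max( C(2m,i) − C(2m,i−2), 0 ), where C(a,b) denotes the binomial coefficient with the convention C(a,b) = 0 for b < 0. In particular, the degree-i component of S/I is zero for i > m and nonzero for i = m, so S/I is a finite-dimensional (Artinian) k-algebra. -/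
open MvPolynomial

namespace SLP
variable {n : ℕ} {k : Type} [Field k]

/-- raising operator -/
noncomputable def U (n : ℕ) (k : Type) [Field k] :
    (Finset (Fin n) → k) →ₗ[k] (Finset (Fin n) → k) where
  toFun f := fun T => ∑ i ∈ T, f (T.erase i)
  map_add' f g := by ext T; simp [Finset.sum_add_distrib]
  map_smul' c f := by ext T; simp [Finset.mul_sum]

/-- lowering operator -/
noncomputable def D (n : ℕ) (k : Type) [Field k] :
    (Finset (Fin n) → k) →ₗ[k] (Finset (Fin n) → k) where
  toFun f := fun T => ∑ i ∈ Tᶜ, f (insert i T)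
  map_add' f g := by ext T; simp [Finset.sum_add_distrib]
  map_smul' c f := by ext T; simp [Finset.mul_sum]

lemma U_apply (f : Finset (Fin n) → k) (T) : U n k f T = ∑ i ∈ T, f (T.erase i) := rfl
lemma D_apply (f : Finset (Fin n) → k) (T) : D n k f T = ∑ i ∈ Tᶜ, f (insert i T) := rfl

/-- graded pieces -/
def V (n : ℕ) (k : Type) [Field k] (i : ℕ) : Submodule k (Finset (Fin n) → k) where
  carrier := {f | ∀ T, T.card ≠ i → f T = 0}
  add_mem' := by intro f g hf hg T hT; simp [hf T hT, hg T hT]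
  zero_mem' := by intro T _; rfl
  smul_mem' := by intro c f hf T hT; simp [hf T hT]

lemma mem_V {i : ℕ} {f : Finset (Fin n) → k} : f ∈ V n k i ↔ ∀ T, T.card ≠ i → f T = 0 := Iff.rfl

lemma DU_apply (f : Finset (Fin n) → k) (T : Finset (Fin n)) :
    D n k (U n k f) T = U n k (D n k f) T + ((n : k) - 2 * (T.card : k)) * f T := by
  have h1 : D n k (U n k f) T = (Tᶜ.card : k) * f T
      + ∑ i ∈ Tᶜ, ∑ j ∈ T, f ((insert i T).erase j) := by
    rw [D_apply, ← nsmul_eq_mul, ← Finset.sum_const, ← Finset.sum_add_distrib]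
    refine Finset.sum_congr rfl fun i hi => ?_
    have hi' : i ∉ T := by simpa using hi
    rw [U_apply, Finset.sum_insert hi', Finset.erase_insert hi']
  have h2 : U n k (D n k f) T = (T.card : k) * f T
      + ∑ j ∈ T, ∑ i ∈ Tᶜ, f ((insert i T).erase j) := by
    rw [U_apply, ← nsmul_eq_mul, ← Finset.sum_const, ← Finset.sum_add_distrib]
    refine Finset.sum_congr rfl fun j hj => ?_
    have hc : (T.erase j)ᶜ = insert j Tᶜ := by
      ext x; simp [Finset.mem_compl]; try tauto
    rw [D_apply, hc, Finset.sum_insert (by simpa using hj), Finset.insert_erase hj]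
    congr 1
    refine Finset.sum_congr rfl fun i hi => ?_
    have hi' : i ∉ T := by simpa using hi
    rw [Finset.erase_insert_of_ne]
    rintro rfl; exact hi' hj
  rw [h1, h2, Finset.sum_comm]
  have h3 : (Tᶜ.card : k) = n - T.card := by
    rw [Finset.card_compl, Nat.cast_sub (by simpa using Finset.card_le_univ T)]; simp
  rw [h3]; ring

lemma U_mem {i : ℕ} {f : Finset (Fin n) → k} (hf : f ∈ V n k i) : U n k f ∈ V n k (i+1) := by
  intro T hT
  rw [U_apply]
  refine Finset.sum_eq_zero fun j hj => hf _ ?_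
  have := Finset.card_erase_add_one hj
  omega

lemma Upow_mem {i : ℕ} {f : Finset (Fin n) → k} (hf : f ∈ V n k i) (r : ℕ) :
    (U n k ^ r) f ∈ V n k (i+r) := by
  induction r with
  | zero => simpa using hf
  | succ r ih => rw [pow_succ', Module.End.mul_apply]; exact U_mem ih

lemma D_mem {i : ℕ} {f : Finset (Fin n) → k} (hf : f ∈ V n k (i+1)) : D n k f ∈ V n k i := by
  intro T hT
  rw [D_apply]
  refine Finset.sum_eq_zero fun j hj => hf _ ?_
  rw [Finset.card_insert_of_notMem (by simpa using hj)]
  omega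

lemma D_zero {f : Finset (Fin n) → k} (hf : f ∈ V n k 0) : D n k f = 0 := by
  ext T
  rw [D_apply]
  refine Finset.sum_eq_zero fun j hj => hf _ ?_
  rw [Finset.card_insert_of_notMem (by simpa using hj)]
  omega

lemma DU {i : ℕ} {f : Finset (Fin n) → k} (hf : f ∈ V n k i) :
    D n k (U n k f) = U n k (D n k f) + ((n : k) - 2 * i) • f := by
  ext T
  rw [DU_apply]
  by_cases h : T.card = i
  · simp [h]
  · simp [hf T h]

lemma U_Upow (f : Finset (Fin n) → k) (r : ℕ) :
    U n k ((U n k ^ r) f) = (U n k ^ (r+1)) f := by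
  rw [pow_succ', Module.End.mul_apply]

lemma DUpow {i : ℕ} {f : Finset (Fin n) → k} (hf : f ∈ V n k i) (r : ℕ) :
    D n k ((U n k ^ (r+1)) f) = (U n k ^ (r+1)) (D n k f)
      + (((r:k)+1) * ((n : k) - 2 * i - r)) • (U n k ^ r) f := by
  induction r with
  | zero => simpa using DU hf
  | succ r ih =>
    rw [← U_Upow f (r+1), DU (Upow_mem hf (r+1)), ih, map_add, map_smul,
      U_Upow, U_Upow, add_assoc, ← add_smul]
    congr 2
    push_cast; ring

lemma inj (hn : ∀ a : ℕ, 1 ≤ a → a ≤ n → (a : k) ≠ 0) (j : ℕ) :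
    ∀ (r : ℕ) (f : Finset (Fin n) → k), f ∈ V n k j → r + 2 * j ≤ n →
    (U n k ^ r) f = 0 → f = 0 := by
  induction j with
  | zero =>
    intro r
    induction r with
    | zero => intro f _ _ h; simpa using h
    | succ r ih =>
      intro f hf hr h
      have := DUpow hf r
      rw [h, D_zero hf, map_zero, map_zero, zero_add, eq_comm, smul_eq_zero] at this
      refine ih f hf (by omega) (this.resolve_left ?_)
      have h1 := hn (r+1) (by omega) (by omega)
      have h2 := hn (n - r) (by omega) (by omega)
      rw [Nat.cast_sub (by omega)] at h2
      push_cast at h1 ⊢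
      refine mul_ne_zero h1 ?_
      simpa using h2
  | succ j ihj =>
    intro r
    induction r with
    | zero => intro f _ _ h; simpa using h
    | succ r ih =>
      intro f hf hr h
      have := DUpow hf r
      have hD : D n k f = 0 := by
        refine ihj (r+2) _ (D_mem hf) (by omega) ?_
        have h3 := congrArg (U n k) this
        rw [map_add, map_smul, U_Upow, U_Upow, h, map_zero, map_zero, smul_zero, add_zero] at h3
        exact h3.symm
      rw [h, hD, map_zero, map_zero, zero_add, eq_comm, smul_eq_zero] at this
      refine ih f hf (by omega) (this.resolve_left ?_)
      have h1 := hn (r+1) (by omega) (by omega)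
      have h2 := hn (n - (2 * (j+1) + r)) (by omega) (by omega)
      rw [Nat.cast_sub (by omega)] at h2
      push_cast at h1 h2 ⊢
      refine mul_ne_zero h1 ?_
      rwa [sub_sub]

lemma finrank_V (i : ℕ) : Module.finrank k (V n k i) = n.choose i := by
  let e : V n k i ≃ₗ[k] ({T : Finset (Fin n) // T.card = i} → k) :=
    { toFun := fun f T => f.1 T.1
      map_add' := fun f g => rfl
      map_smul' := fun c f => rfl
      invFun := fun g => ⟨fun T => if h : T.card = i then g ⟨T, h⟩ else 0, by
        intro T hT; simp [hT]⟩
      left_inv := by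
        intro f; ext T
        by_cases h : T.card = i
        · simp [h]
        · simp [h, f.2 T h]
      right_inv := by
        intro g; ext T; simp [T.2] }
  rw [e.finrank_eq, Module.finrank_fintype_fun_eq_card, Fintype.card_finset_len]
  simp

/-- truncation -/
def tr (i : ℕ) (f : Finset (Fin n) → k) : Finset (Fin n) → k :=
  fun T => if T.card = i then f T else 0

lemma tr_mem (i : ℕ) (f : Finset (Fin n) → k) : tr i f ∈ V n k i := by
  intro T hT; simp [tr, hT]

lemma tr_eq {i : ℕ} {f : Finset (Fin n) → k} (hf : f ∈ V n k i) : tr i f = f := by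
  ext T
  by_cases h : T.card = i
  · simp [tr, h]
  · simp [tr, h, hf T h]

lemma tr_U (i : ℕ) (f : Finset (Fin n) → k) : tr (i+1) (U n k f) = U n k (tr i f) := by
  ext T
  simp only [tr, U_apply]
  split_ifs with h
  · refine Finset.sum_congr rfl fun j hj => ?_
    have := Finset.card_erase_add_one hj
    rw [if_pos (by omega)]
  · symm
    refine Finset.sum_eq_zero fun j hj => ?_
    have := Finset.card_erase_add_one hj
    rw [if_neg (by omega)]

lemma tr_U_zero (f : Finset (Fin n) → k) : tr 0 (U n k f) = 0 := by
  ext T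
  simp only [tr, U_apply, Finset.card_eq_zero]
  split_ifs with h
  · simp [h]
  · rfl

/-- kernel description -/
lemma inf_range (j : ℕ) : V n k (j+2) ⊓ LinearMap.range (U n k ^ 2) = (V n k j).map (U n k ^ 2) := by
  ext f
  constructor
  · rintro ⟨hf, g, rfl⟩
    refine ⟨tr j g, tr_mem _ _, ?_⟩
    rw [← tr_eq hf]
    simp only [pow_two, Module.End.mul_apply, tr_U]
  · rintro ⟨g, hg, rfl⟩
    exact ⟨Upow_mem hg 2, g, rfl⟩

lemma inf_range_small (i : ℕ) (hi : i < 2) : V n k i ⊓ LinearMap.range (U n k ^ 2) = ⊥ := by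
  rw [eq_bot_iff]
  rintro f ⟨hf, g, rfl⟩
  rw [Submodule.mem_bot, ← tr_eq hf]
  simp only [pow_two, Module.End.mul_apply]
  interval_cases i
  · rw [tr_U_zero]
  · rw [tr_U, tr_U_zero, map_zero]

/-- exponent vector of a squarefree monomial -/
noncomputable def e (T : Finset (Fin n)) : Fin n →₀ ℕ :=
  Finsupp.equivFunOnFinite.symm (fun i => if i ∈ T then 1 else 0)

lemma e_apply (T : Finset (Fin n)) (i) : e T i = if i ∈ T then 1 else 0 := rfl

lemma e_inj : Function.Injective (e (n := n)) := by
  intro S T h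
  ext i
  have := DFunLike.congr_fun h i
  simp only [e_apply] at this
  split_ifs at this <;> simp_all

lemma e_deg (T : Finset (Fin n)) : (e T).degree = T.card := by
  simp [Finsupp.degree_eq_sum, e_apply]

/-- squarefree coefficients -/
noncomputable def phi (n : ℕ) (k : Type) [Field k] :
    MvPolynomial (Fin n) k →ₗ[k] (Finset (Fin n) → k) :=
  LinearMap.pi fun T => lcoeff k (e T)

lemma phi_apply (p : MvPolynomial (Fin n) k) (T) : phi n k p T = coeff (e T) p := rfl

lemma phi_X_mul (i : Fin n) (p : MvPolynomial (Fin n) k) (T) :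
    phi n k (X i * p) T = if i ∈ T then phi n k p (T.erase i) else 0 := by
  rw [phi_apply, coeff_X_mul']
  have h : i ∈ (e T).support ↔ i ∈ T := by simp [e_apply]
  simp only [h]
  split_ifs with hi
  · rw [phi_apply]
    congr 1
    ext j
    rw [Finsupp.tsub_apply, e_apply, e_apply, Finsupp.single_apply]
    by_cases hj : i = j
    · subst hj; simp [hi]
    · simp [hj, Ne.symm hj]
  · rfl

lemma phi_sq_mul (i : Fin n) (p : MvPolynomial (Fin n) k) : phi n k (X i ^ 2 * p) = 0 := by
  ext T
  rw [pow_two, mul_assoc, phi_X_mul, phi_X_mul]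
  simp

lemma phi_l_mul (p : MvPolynomial (Fin n) k) :
    phi n k ((∑ j, X j) * p) = U n k (phi n k p) := by
  ext T
  rw [Finset.sum_mul, map_sum, Finset.sum_apply, U_apply]
  simp only [phi_X_mul]
  simp

lemma phi_l2_mul (p : MvPolynomial (Fin n) k) :
    phi n k ((∑ j, X j) ^ 2 * p) = (U n k ^ 2) (phi n k p) := by
  rw [pow_two, mul_assoc, phi_l_mul, phi_l_mul, pow_two]; rfl

/-- section of `phi` -/
noncomputable def sec (n : ℕ) (k : Type) [Field k] :
    (Finset (Fin n) → k) →ₗ[k] MvPolynomial (Fin n) k :=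
  ∑ T : Finset (Fin n), (monomial (e T)).comp (LinearMap.proj T)

lemma sec_apply (f : Finset (Fin n) → k) : sec n k f = ∑ T, monomial (e T) (f T) := by
  simp [sec]

lemma phi_sec (f : Finset (Fin n) → k) : phi n k (sec n k f) = f := by
  ext T
  rw [phi_apply, sec_apply, coeff_sum]
  simp [coeff_monomial, e_inj.eq_iff]

/-- the ideal -/
noncomputable def J (n : ℕ) (k : Type) [Field k] : Ideal (MvPolynomial (Fin n) k) := Ideal.span
      ((Set.range fun j : Fin n => (X j : MvPolynomial (Fin n) k) ^ 2) ∪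
        {(∑ j : Fin n, X j) ^ 2})

lemma X_sq_mem (i : Fin n) : (X i : MvPolynomial (Fin n) k) ^ 2 ∈ J n k :=
  Ideal.subset_span (Or.inl ⟨i, rfl⟩)

lemma l_sq_mem : (∑ i : Fin n, X i : MvPolynomial (Fin n) k) ^ 2 ∈ J n k :=
  Ideal.subset_span (Or.inr rfl)

lemma phi_mem {p : MvPolynomial (Fin n) k} (hp : p ∈ J n k) :
    phi n k p ∈ LinearMap.range (U n k ^ 2) := by
  suffices h : ∀ a, phi n k (a * p) ∈ LinearMap.range (U n k ^ 2) by simpa using h 1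
  unfold J at hp
  induction hp using Submodule.span_induction with
  | mem x hx =>
    intro a
    rcases hx with ⟨i, rfl⟩ | rfl
    · rw [mul_comm, phi_sq_mul]; exact zero_mem _
    · rw [mul_comm, phi_l2_mul]; exact ⟨_, rfl⟩
  | zero => intro a; simp
  | add x y _ _ hx hy => intro a; rw [mul_add, map_add]; exact add_mem (hx a) (hy a)
  | smul b x _ hx => intro a; rw [smul_eq_mul, ← mul_assoc]; exact hx _

lemma sec_phi_monomial (d : Fin n →₀ ℕ) (c : k) :
    monomial d c - sec n k (phi n k (monomial d c)) ∈ J n k := by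
  by_cases h : ∃ i, 2 ≤ d i
  · obtain ⟨i, hi⟩ := h
    have hm : (monomial d c : MvPolynomial (Fin n) k) =
        X i ^ 2 * monomial (d - Finsupp.single i 2) c := by
      rw [X_pow_eq_monomial, monomial_mul, one_mul, add_tsub_cancel_of_le]
      simpa using hi
    rw [hm, phi_sq_mul, map_zero, sub_zero]
    exact Ideal.mul_mem_right _ _ (X_sq_mem i)
  · push Not at h
    have hd : d = e d.support := by
      ext i
      rw [e_apply]
      have := h i
      simp only [Finsupp.mem_support_iff]
      split_ifs <;> omega
    generalize d.support = T at hd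
    subst hd
    convert (J n k).zero_mem
    rw [sub_eq_zero, sec_apply, Finset.sum_eq_single T]
    · rw [phi_apply]; simp
    · intro S _ hS
      rw [phi_apply, coeff_monomial, if_neg (fun h => hS (e_inj h).symm), map_zero]
    · simp

lemma sec_phi (p : MvPolynomial (Fin n) k) : p - sec n k (phi n k p) ∈ J n k := by
  induction p using MvPolynomial.induction_on' with
  | monomial d c => exact sec_phi_monomial d c
  | add p q hp hq =>
    rw [map_add, map_add, add_sub_add_comm]
    exact add_mem hp hq

/-- the map to the quotient -/
noncomputable def psi (n : ℕ) (k : Type) [Field k] :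
    (Finset (Fin n) → k) →ₗ[k] (MvPolynomial (Fin n) k ⧸ J n k) :=
  (Ideal.Quotient.mkₐ k (J n k)).toLinearMap.comp (sec n k)

lemma psi_phi (p : MvPolynomial (Fin n) k) :
    psi n k (phi n k p) = Ideal.Quotient.mkₐ k (J n k) p := by
  symm
  exact Ideal.Quotient.eq.2 (sec_phi p)

lemma ker_psi : LinearMap.ker (psi n k) = LinearMap.range (U n k ^ 2) := by
  ext f
  constructor
  · intro h
    have : sec n k f ∈ J n k := Ideal.Quotient.eq_zero_iff_mem.1 h
    simpa [phi_sec] using phi_mem this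
  · rintro ⟨g, rfl⟩
    rw [LinearMap.mem_ker, ← phi_sec g, ← phi_l2_mul, psi_phi]
    exact Ideal.Quotient.eq_zero_iff_mem.2 (Ideal.mul_mem_right _ _ l_sq_mem)

/-- graded component -/
noncomputable def Q (n : ℕ) (k : Type) [Field k] (i : ℕ) :
    Submodule k (MvPolynomial (Fin n) k ⧸ J n k) :=
  Submodule.map (Ideal.Quotient.mkₐ k (J n k)).toLinearMap (homogeneousSubmodule (Fin n) k i)

lemma map_psi (i : ℕ) : (V n k i).map (psi n k) = Q n k i := by
  ext q
  constructor
  · rintro ⟨f, hf, rfl⟩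
    refine ⟨sec n k f, ?_, rfl⟩
    rw [sec_apply]
    refine Submodule.sum_mem _ fun T _ => ?_
    by_cases h : T.card = i
    · exact isHomogeneous_monomial _ (by rw [e_deg, h])
    · rw [hf T h, map_zero]; exact zero_mem _
  · rintro ⟨p, hp, rfl⟩
    refine ⟨phi n k p, ?_, psi_phi p⟩
    intro T hT
    rw [phi_apply]
    refine IsHomogeneous.coeff_eq_zero hp ?_
    rwa [e_deg]

lemma finrank_Q (i : ℕ) : Module.finrank k (Q n k i) +
    Module.finrank k (V n k i ⊓ LinearMap.range (U n k ^ 2) : Submodule k _) = n.choose i := by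
  rw [← map_psi, ← finrank_V (k := k) i, ← ker_psi]
  have := LinearMap.finrank_range_add_finrank_ker ((psi n k).domRestrict (V n k i))
  rw [← this, LinearMap.range_domRestrict]
  congr 1
  rw [LinearMap.ker_domRestrict]
  have hc : (LinearMap.ker (psi n k)).comap (V n k i).subtype =
      (V n k i ⊓ LinearMap.ker (psi n k)).comap (V n k i).subtype := by
    simp
  rw [hc]
  exact (Submodule.comapSubtypeEquivOfLe inf_le_left).finrank_eq.symm

lemma finrank_Q_small (i : ℕ) (hi : i < 2) : Module.finrank k (Q n k i) = n.choose i := by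
  have := finrank_Q (n := n) (k := k) i
  rwa [inf_range_small i hi, finrank_bot, add_zero] at this

lemma finrank_Q_mid (hn : ∀ a : ℕ, 1 ≤ a → a ≤ n → (a : k) ≠ 0) (j : ℕ) (hj : 2 + 2 * j ≤ n) :
    Module.finrank k (Q n k (j+2)) + n.choose j = n.choose (j+2) := by
  rw [← finrank_Q (n := n) (k := k) (j+2), inf_range, ← finrank_V (k := k) j,
    ← LinearMap.range_domRestrict, LinearMap.finrank_range_of_inj]
  rw [← LinearMap.ker_eq_bot, LinearMap.ker_eq_bot']
  rintro ⟨f, hf⟩ h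
  exact Subtype.ext (inj hn j 2 f hf hj h)

lemma Q_bot_iff (i : ℕ) : Q n k i = ⊥ ↔ ∀ d : Fin n →₀ ℕ, d.degree = i →
    (monomial d 1 : MvPolynomial (Fin n) k) ∈ J n k := by
  constructor
  · intro h d hd
    have : Ideal.Quotient.mkₐ k (J n k) (monomial d 1) ∈ Q n k i :=
      ⟨_, isHomogeneous_monomial _ hd, rfl⟩
    rw [h] at this
    exact Ideal.Quotient.eq_zero_iff_mem.1 this
  · intro h
    rw [eq_bot_iff]
    rintro _ ⟨p, hp, rfl⟩
    refine Ideal.Quotient.eq_zero_iff_mem.2 ?_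
    rw [p.as_sum]
    refine Ideal.sum_mem _ fun d hd => ?_
    have hdd : d.degree = i := by
      by_contra hne
      exact (mem_support_iff.1 hd) (IsHomogeneous.coeff_eq_zero hp hne)
    rw [← mul_one (coeff d p), ← C_mul_monomial]
    exact Ideal.mul_mem_left _ _ (h d hdd)

lemma Q_bot_succ (i : ℕ) (h : Q n k i = ⊥) : Q n k (i+1) = ⊥ := by
  rw [Q_bot_iff] at h ⊢
  intro d hd
  have hne : d ≠ 0 := by rintro rfl; simp at hd
  obtain ⟨j, hj⟩ := Finsupp.ne_iff.1 hne
  have hle : Finsupp.single j 1 ≤ d := by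
    simp at hj ⊢; omega
  have hd2 : d = Finsupp.single j 1 + (d - Finsupp.single j 1) := (add_tsub_cancel_of_le hle).symm
  generalize d - Finsupp.single j 1 = d' at hd2
  subst hd2
  rw [map_add, Finsupp.degree_single] at hd
  have := Ideal.mul_mem_left (J n k) (X j) (h d' (by omega))
  rwa [X, monomial_mul, one_mul] at this

lemma finite_quot : FiniteDimensional k (MvPolynomial (Fin n) k ⧸ J n k) := by
  refine Module.Finite.of_surjective (psi n k) ?_
  intro q
  obtain ⟨p, rfl⟩ := Ideal.Quotient.mk_surjective q
  exact ⟨phi n k p, psi_phi p⟩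

lemma main (m : ℕ) (hm : 2 ≤ m) (hn : ∀ a : ℕ, 1 ≤ a → a ≤ 2 * m → (a : k) ≠ 0) :
    (∀ i : ℕ,
      (Module.finrank k (Q (2 * m) k i) : ℤ) =
        max ((Nat.choose (2 * m) i : ℤ) -
          (if 2 ≤ i then (Nat.choose (2 * m) (i - 2) : ℤ) else 0)) 0) ∧
    (∀ i : ℕ, m < i → Q (2 * m) k i = ⊥) ∧ Q (2 * m) k m ≠ ⊥ ∧
    FiniteDimensional k (MvPolynomial (Fin (2 * m)) k ⧸ J (2 * m) k) := by
  have := finite_quot (n := 2 * m) (k := k)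
  have hbot : ∀ i : ℕ, m < i → Q (2 * m) k i = ⊥ := by
    intro i hi
    induction i, hi using Nat.le_induction with
    | base =>
      rw [← Submodule.finrank_eq_zero (R := k)]
      obtain ⟨j, rfl⟩ : ∃ j, m = j + 1 := ⟨m - 1, by omega⟩
      have := finrank_Q_mid hn j (by omega)
      have h2 : (2 * (j+1)).choose j = (2 * (j+1)).choose (j+2) := by
        rw [← Nat.choose_symm (by omega)]; congr 1; omega
      change Module.finrank k (Q (2 * (j+1)) k (j+2)) = 0
      omega
    | succ i hi ih => exact Q_bot_succ i ih
  refine ⟨?_, hbot, ?_, this⟩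
  · intro i
    rcases lt_or_ge i 2 with h | h
    · rw [finrank_Q_small i h, if_neg (by omega)]; simp
    · obtain ⟨j, rfl⟩ : ∃ j, i = j + 2 := ⟨i - 2, by omega⟩
      rw [if_pos h, Nat.add_sub_cancel]
      rcases le_or_gt (2 + 2 * j) (2 * m) with h2 | h2
      · have := finrank_Q_mid hn j h2
        omega
      · rw [hbot _ (by omega), finrank_bot]
        have : (2 * m).choose (j+2) ≤ (2 * m).choose j := by
          rcases lt_or_ge (2 * m) (j+2) with h3 | h3
          · rw [Nat.choose_eq_zero_of_lt h3]; exact Nat.zero_le _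
          · rw [← Nat.choose_symm h3, ← Nat.choose_symm (show j ≤ 2 * m by omega)]
            have e1 : 2 * m - j = (2 * m - (j+2)) + 1 + 1 := by omega
            rw [e1]
            exact (Nat.choose_le_succ_of_lt_half_left (by omega)).trans
              (Nat.choose_le_succ_of_lt_half_left (by omega))
        omega
  · intro h
    obtain ⟨j, rfl⟩ : ∃ j, m = j + 2 := ⟨m - 2, by omega⟩
    have h1 := finrank_Q_mid hn j (by omega)
    rw [h, finrank_bot, zero_add] at h1
    have h2 : (2 * (j+2)).choose j ≤ (2 * (j+2)).choose (j+1) :=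
      Nat.choose_le_succ_of_lt_half_left (by omega)
    have h3 := Nat.choose_succ_right_eq (2 * (j+2)) (j+1)
    have h4 : 2 * (j+2) - (j+1) = j + 3 := by omega
    rw [h4] at h3
    have h5 : 0 < (2 * (j+2)).choose (j+2) := Nat.choose_pos (by omega)
    nlinarith

end SLP

theorem stmt_1 (m : ℕ) (hm : 2 ≤ m) (k : Type) [Field k]
    (hchar : ringChar k = 0 ∨ 2 * m + 1 < ringChar k)
    (I : Ideal (MvPolynomial (Fin (2 * m)) k))
    (hI : I = Ideal.span
      ((Set.range fun j : Fin (2 * m) => (X j : MvPolynomial (Fin (2 * m)) k) ^ 2) ∪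
        {(∑ j : Fin (2 * m), X j) ^ 2})) :
    (∀ i : ℕ,
      (Module.finrank k
        (Submodule.map (Ideal.Quotient.mkₐ k I).toLinearMap
          (homogeneousSubmodule (Fin (2 * m)) k i)) : ℤ) =
        max ((Nat.choose (2 * m) i : ℤ) -
          (if 2 ≤ i then (Nat.choose (2 * m) (i - 2) : ℤ) else 0)) 0) ∧
    (∀ i : ℕ, m < i →
      Submodule.map (Ideal.Quotient.mkₐ k I).toLinearMap
        (homogeneousSubmodule (Fin (2 * m)) k i) = ⊥) ∧
    Submodule.map (Ideal.Quotient.mkₐ k I).toLinearMap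
        (homogeneousSubmodule (Fin (2 * m)) k m) ≠ ⊥ ∧
    FiniteDimensional k (MvPolynomial (Fin (2 * m)) k ⧸ I) := by
  subst hI
  refine SLP.main m hm ?_
  intro a h1 h2 h0
  have hd := (ringChar.spec k a).1 h0
  rcases hchar with h | h
  · rw [h, zero_dvd_iff] at hd; omega
  · have := Nat.le_of_dvd (by omega) hd; omega
end

section
/- Let m ≥ 2 be an integer and let k be a field with char(k) = 0 or char(k) > 2m+1. Let S = k[x_1,…,x_{2m}], let C be the ideal generated by x_1^2, …, x_{2m}^2, and let ℓ = x_1 + ⋯ + x_{2m}. Then: (a) for every homogeneous polynomial f of degree at most m−1, if ℓ^2·f ∈ C then f ∈ C; and (b) there exists a homogeneous polynomial f of degree m with ℓ^2·f ∈ C but f ∉ C. Consequently the colon ideal L = C : (ℓ^2) agrees with C in all degrees below m but not in degree m. -/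
open MvPolynomial

namespace Lefschetz

variable {n : ℕ} {k : Type} [Field k]

/-- The lowering operator of the `sl_2`-action, one variable at a time. -/
noncomputable def low1 (j : Fin n) (f : MvPolynomial (Fin n) k) : MvPolynomial (Fin n) k :=
  pderiv j f - X j * pderiv j (pderiv j f)

/-- The lowering operator. -/
noncomputable def low (f : MvPolynomial (Fin n) k) : MvPolynomial (Fin n) k :=
  ∑ j, low1 j f

/-- The ideal of squares. -/
noncomputable def sqI (n : ℕ) (k : Type) [Field k] : Ideal (MvPolynomial (Fin n) k) :=
  Ideal.span (Set.range fun j : Fin n => (X j : MvPolynomial (Fin n) k) ^ 2)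

/-- The linear form. -/
noncomputable def lin (n : ℕ) (k : Type) [Field k] : MvPolynomial (Fin n) k := ∑ j, X j

lemma X_sq_mem (j : Fin n) : (X j : MvPolynomial (Fin n) k) ^ 2 ∈ sqI n k :=
  Ideal.subset_span ⟨j, rfl⟩

lemma low1_add (j : Fin n) (f g : MvPolynomial (Fin n) k) :
    low1 j (f + g) = low1 j f + low1 j g := by
  simp only [low1, map_add]; ring

lemma low1_zero (j : Fin n) : low1 j (0 : MvPolynomial (Fin n) k) = 0 := by
  simp [low1]

lemma low1_mem (j : Fin n) (f : MvPolynomial (Fin n) k) (hf : f ∈ sqI n k) :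
    low1 j f ∈ sqI n k := by
  obtain ⟨c, rfl⟩ := Ideal.mem_span_range_iff_exists_fun.1 hf
  refine Finset.sum_induction _ (fun g => low1 j g ∈ sqI n k) ?_ ?_ ?_
  · intro x y hx hy
    rw [low1_add]; exact add_mem hx hy
  · rw [low1_zero]; exact zero_mem _
  · intro i _
    by_cases h : i = j
    · subst h
      have : low1 i (c i * (X i : MvPolynomial (Fin n) k) ^ 2) =
          (-3 * pderiv i (c i) - X i * pderiv i (pderiv i (c i))) * X i ^ 2 := by
        simp only [low1, pow_two, Derivation.leibniz, pderiv_X_self, smul_eq_mul, map_add, mul_one]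
        ring
      rw [this]
      exact Ideal.mul_mem_left _ _ (X_sq_mem i)
    · have : low1 j (c i * (X i : MvPolynomial (Fin n) k) ^ 2) = low1 j (c i) * X i ^ 2 := by
        simp only [low1, pow_two, Derivation.leibniz, pderiv_X_of_ne h, smul_eq_mul, map_add,
          mul_zero, add_zero, zero_add]
        ring
      rw [this]
      exact Ideal.mul_mem_left _ _ (X_sq_mem i)

lemma low_mem (f : MvPolynomial (Fin n) k) (hf : f ∈ sqI n k) : low f ∈ sqI n k :=
  Ideal.sum_mem _ fun j _ => low1_mem j f hf

lemma pderiv_lin (j : Fin n) : pderiv j (lin n k) = 1 := by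
  simp [lin, pderiv_X, Pi.single_apply]

lemma low_lin_mul (f : MvPolynomial (Fin n) k) (d : ℕ) (hf : f.IsHomogeneous d) :
    low (lin n k * f) = lin n k * low f + ((n : MvPolynomial (Fin n) k) - 2 * d) * f := by
  have h1 : ∀ j, low1 j (lin n k * f) = lin n k * low1 j f + (f - 2 * (X j * pderiv j f)) := by
    intro j
    simp only [low1, Derivation.leibniz, pderiv_lin, smul_eq_mul, map_add, mul_one]
    ring
  have h2 := hf.sum_X_mul_pderiv
  rw [nsmul_eq_mul] at h2
  simp only [low, h1, Finset.sum_add_distrib, Finset.sum_sub_distrib, ← Finset.mul_sum, h2]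
  simp
  ring

lemma lin_hom : (lin n k).IsHomogeneous 1 :=
  IsHomogeneous.sum _ _ _ fun j _ => isHomogeneous_X k j

lemma low_lin_pow (f : MvPolynomial (Fin n) k) (d : ℕ) (hf : f.IsHomogeneous d) (a : ℕ) :
    low (lin n k ^ (a + 1) * f) = lin n k ^ (a + 1) * low f +
      ((a + 1) * ((n : MvPolynomial (Fin n) k) - 2 * d - a)) * (lin n k ^ a * f) := by
  induction a with
  | zero => simp [low_lin_mul f d hf]
  | succ a ih =>
    have h : (lin n k ^ (a + 1) * f).IsHomogeneous (1 * (a + 1) + d) := (lin_hom.pow (a + 1)).mul hf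
    rw [pow_succ' _ (a + 1), mul_assoc, low_lin_mul _ _ h, ih]
    push_cast
    ring

lemma low_hom (f : MvPolynomial (Fin n) k) (d : ℕ) (hf : f.IsHomogeneous (d + 1)) :
    (low f).IsHomogeneous d := by
  refine IsHomogeneous.sum _ _ _ fun j _ => ?_
  have h1 : (pderiv j f).IsHomogeneous d := hf.pderiv
  refine h1.sub ?_
  rcases d with _ | d
  · rw [← totalDegree_zero_iff_isHomogeneous, totalDegree_eq_zero_iff_eq_C] at h1
    rw [h1]
    simp [isHomogeneous_zero]
  · have := (isHomogeneous_X k j).mul (h1.pderiv (i := j))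
    simpa [add_comm] using this

lemma low_hom_zero (f : MvPolynomial (Fin n) k) (hf : f.IsHomogeneous 0) : low f = 0 := by
  rw [← totalDegree_zero_iff_isHomogeneous, totalDegree_eq_zero_iff_eq_C] at hf
  rw [hf]
  simp [low, low1]

lemma step (hk : ∀ t : ℕ, 1 ≤ t → t ≤ n → (t : k) ≠ 0) (d a : ℕ) (ha : a + 1 + 2 * d ≤ n)
    (f : MvPolynomial (Fin n) k) (hf : f.IsHomogeneous d)
    (h : lin n k ^ (a + 1) * f ∈ sqI n k) (h0 : low f ∈ sqI n k) :
    lin n k ^ a * f ∈ sqI n k := by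
  have e := low_lin_pow f d hf a
  obtain ⟨t, ht⟩ : ∃ t, n = t + 1 + 2 * d + a := ⟨n - (1 + 2 * d + a), by omega⟩
  have hc : (((a : MvPolynomial (Fin n) k) + 1) * ((n : MvPolynomial (Fin n) k) - 2 * d - a)) =
      (C (((a + 1 : ℕ) : k) * ((t + 1 : ℕ) : k)) : MvPolynomial (Fin n) k) := by
    have : (n : MvPolynomial (Fin n) k) = ((t + 1 + 2 * d + a : ℕ) : MvPolynomial (Fin n) k) := by
      rw [← ht]
    rw [this, C_mul, map_natCast, map_natCast]
    push_cast
    ring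
  have hne : (((a + 1 : ℕ) : k) * ((t + 1 : ℕ) : k)) ≠ 0 :=
    mul_ne_zero (hk _ (by omega) (by omega)) (hk _ (by omega) (by omega))
  rw [hc] at e
  generalize (((a + 1 : ℕ) : k) * ((t + 1 : ℕ) : k)) = u at e hne
  have h3 : C u * (lin n k ^ a * f) ∈ sqI n k := by
    rw [← sub_eq_iff_eq_add'.2 e]
    exact sub_mem (low_mem _ h) (Ideal.mul_mem_left _ _ h0)
  have h4 := Ideal.mul_mem_left _ (C u⁻¹) h3
  rwa [← mul_assoc, ← C_mul, inv_mul_cancel₀ hne, C_1, one_mul] at h4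

/-- Even index. -/
def ev {m : ℕ} (i : Fin m) : Fin (2 * m) := ⟨2 * i, by omega⟩

/-- Odd index. -/
def od {m : ℕ} (i : Fin m) : Fin (2 * m) := ⟨2 * i + 1, by omega⟩

lemma lin_split (m : ℕ) : lin (2 * m) k = ∑ i : Fin m, (X (ev i) + X (od i)) := by
  unfold lin
  rw [← (finCongr (Nat.mul_comm m 2)).sum_comp, ← finProdFinEquiv.sum_comp,
    Fintype.sum_prod_type]
  refine Finset.sum_congr rfl fun i _ => ?_
  rw [Fin.sum_univ_two]
  congr 2 <;> ext <;> simp [ev, od] <;> ring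

/-- The kernel element. -/
noncomputable def ker (m : ℕ) (k : Type) [Field k] : MvPolynomial (Fin (2 * m)) k :=
  ∏ i : Fin m, (X (ev i) - X (od i))

lemma ker_hom (m : ℕ) : (ker m k).IsHomogeneous m := by
  have := IsHomogeneous.prod (Finset.univ : Finset (Fin m))
    (fun i => (X (ev i) - X (od i) : MvPolynomial (Fin (2 * m)) k)) (fun _ => 1)
    (fun i _ => (isHomogeneous_X k _).sub (isHomogeneous_X k _))
  simpa [ker] using this

lemma ker_mem (m : ℕ) : lin (2 * m) k * ker m k ∈ sqI (2 * m) k := by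
  rw [lin_split, Finset.sum_mul]
  refine Ideal.sum_mem _ fun i _ => ?_
  rw [ker, ← Finset.mul_prod_erase _ _ (Finset.mem_univ i), ← mul_assoc]
  refine Ideal.mul_mem_right _ _ ?_
  have : ((X (ev i) + X (od i)) * (X (ev i) - X (od i)) : MvPolynomial (Fin (2 * m)) k) =
    X (ev i) ^ 2 - X (od i) ^ 2 := by ring
  rw [this]
  exact sub_mem (X_sq_mem _) (X_sq_mem _)

lemma ker_not_mem (m : ℕ) : ker m k ∉ sqI (2 * m) k := by
  intro h
  let φ : MvPolynomial (Fin (2 * m)) k →ₐ[k] MvPolynomial (Fin m) k :=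
    aeval fun j => if j.1 % 2 = 0 then X ⟨j.1 / 2, by omega⟩ else 0
  have h1 : φ (ker m k) = monomial (∑ i : Fin m, Finsupp.single i 1) 1 := by
    rw [ker, map_prod, monomial_sum_one]
    refine Finset.prod_congr rfl fun i _ => ?_
    have e2 : (2 * i.1 + 1) % 2 = 1 := by omega
    change _ = X i
    simp [φ, ev, od, e2]
  have h2 : φ (ker m k) ∈ Ideal.span ((fun s => monomial s (1 : k)) ''
      (Set.range fun i : Fin m => Finsupp.single i 2)) := by
    have h3 := Ideal.mem_map_of_mem φ h
    refine (?_ : Ideal.map φ (sqI (2 * m) k) ≤ _) h3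
    rw [sqI, Ideal.map_span, Ideal.span_le]
    rintro _ ⟨_, ⟨j, rfl⟩, rfl⟩
    by_cases hj : j.1 % 2 = 0
    · refine Ideal.subset_span ⟨_, ⟨⟨j.1 / 2, by omega⟩, rfl⟩, ?_⟩
      simp only [← X_pow_eq_monomial]
      simp [φ, hj]
    · simp [φ, hj]
  rw [mem_ideal_span_monomial_image, h1] at h2
  obtain ⟨_, ⟨i, rfl⟩, hi⟩ := h2 (∑ i : Fin m, Finsupp.single i 1) (by simp)
  have := hi i
  simp [Finsupp.single_apply] at this

lemma inj (hk : ∀ t : ℕ, 1 ≤ t → t ≤ n → (t : k) ≠ 0) (d : ℕ) :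
    ∀ a : ℕ, a + 2 * d ≤ n → ∀ f : MvPolynomial (Fin n) k, f.IsHomogeneous d →
      lin n k ^ a * f ∈ sqI n k → f ∈ sqI n k := by
  induction d with
  | zero =>
    intro a
    induction a with
    | zero => intro _ f _ h; simpa using h
    | succ a iha =>
      intro ha f hf h
      have h0 : low f ∈ sqI n k := by rw [low_hom_zero f hf]; exact zero_mem _
      exact iha (by omega) f hf (step hk 0 a ha f hf h h0)
  | succ d ihd =>
    intro a
    induction a with
    | zero => intro _ f _ h; simpa using h
    | succ a iha =>
      intro ha f hf h
      have h0 : low f ∈ sqI n k := by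
        refine ihd (a + 2) (by omega) (low f) (low_hom f d hf) ?_
        have e := low_lin_pow f (d + 1) hf a
        have e2 : lin n k ^ (a + 2) * low f = lin n k * low (lin n k ^ (a + 1) * f) -
            ((a + 1) * ((n : MvPolynomial (Fin n) k) - 2 * (d + 1 : ℕ) - a)) *
              (lin n k ^ (a + 1) * f) := by
          rw [e]; ring
        rw [e2]
        exact sub_mem (Ideal.mul_mem_left _ _ (low_mem _ h)) (Ideal.mul_mem_left _ _ h)
      exact iha (by omega) f hf (step hk (d + 1) a ha f hf h h0)

end Lefschetz

open Lefschetz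

/-- Strong Lefschetz behaviour of `ℓ² = (x_1+⋯+x_{2m})²` on the monomial complete
intersection `S/C`, `C = (x_1^2,…,x_{2m}^2)`: (a) multiplication by `ℓ²` is injective
on graded components of degree `≤ m−1`, i.e. for homogeneous `f` of degree `≤ m−1`,
`ℓ²·f ∈ C → f ∈ C`; and (b) it fails to be injective in degree `m`, i.e. there is a
homogeneous `f` of degree `m` with `ℓ²·f ∈ C` but `f ∉ C`. -/
theorem stmt_2 (m : ℕ) (hm : 2 ≤ m) (k : Type) [Field k]
    (hchar : ringChar k = 0 ∨ 2 * m + 1 < ringChar k)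
    (C : Ideal (MvPolynomial (Fin (2 * m)) k))
    (hC : C = Ideal.span
      (Set.range fun j : Fin (2 * m) => (X j : MvPolynomial (Fin (2 * m)) k) ^ 2))
    (l : MvPolynomial (Fin (2 * m)) k) (hl : l = ∑ j : Fin (2 * m), X j) :
    (∀ d : ℕ, d ≤ m - 1 →
      ∀ f ∈ homogeneousSubmodule (Fin (2 * m)) k d, l ^ 2 * f ∈ C → f ∈ C) ∧
    (∃ f ∈ homogeneousSubmodule (Fin (2 * m)) k m, l ^ 2 * f ∈ C ∧ f ∉ C) := by
  subst hC hl
  have hk : ∀ t : ℕ, 1 ≤ t → t ≤ 2 * m → (t : k) ≠ 0 := by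
    intro t h1 h2 h
    rw [ringChar.spec] at h
    rcases hchar with h0 | h0
    · rw [h0, zero_dvd_iff] at h; omega
    · have := Nat.le_of_dvd h1 h; omega
  refine ⟨fun d hd f hf h => ?_, ker m k, ker_hom m, ?_, ker_not_mem m⟩
  · exact inj hk d 2 (by omega) f hf h
  · have := Ideal.mul_mem_left _ (lin (2 * m) k) (ker_mem (k := k) m)
    rw [← mul_assoc, ← pow_two] at this
    exact this
end

section
/- For every integer n ≥ 5, the strict inequality C(4n,n) − C(4n,n−2) + C(4n,n+1) − C(4n,n−1) < C(4n,2n) − C(4n,2n−2) holds. -/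
theorem fact_ineq (n : ℕ) (hn : 5 ≤ n) :
    32 * (2 * n + 1) * (n + 1) * ((2 * n).factorial) ^ 2
      < 9 * (4 * n + 1) * (n.factorial * (3 * n).factorial) := by
  induction n, hn using Nat.le_induction with
  | base => norm_num [Nat.factorial]
  | succ n hn ih =>
    have h2 : (2 * (n + 1)).factorial = (2 * n + 2) * ((2 * n + 1) * (2 * n).factorial) := rfl
    have h3 : (3 * (n + 1)).factorial
        = (3 * n + 3) * ((3 * n + 2) * ((3 * n + 1) * (3 * n).factorial)) := rfl
    rw [h2, h3, Nat.factorial_succ]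
    have hQ : 0 < ((2 * n).factorial) ^ 2 := by positivity
    generalize hP' : n.factorial * (3 * n).factorial = P at ih
    generalize ((2 * n).factorial) = q at *
    have key : (4 * n + 1) * (2 * n + 3) * (n + 2) * (4 * (2 * n + 1))
        ≤ (4 * n + 5) * (3 * (3 * n + 2) * (3 * n + 1)) * (n + 1) := by
      obtain ⟨k, rfl⟩ := Nat.exists_eq_add_of_le hn
      ring_nf
      nlinarith [Nat.zero_le k, Nat.zero_le (k^2), Nat.zero_le (k^3), Nat.zero_le (k^4)]
    have e1 : 9 * (4 * (n + 1) + 1) * ((n + 1) * n.factorial *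
        ((3 * n + 3) * ((3 * n + 2) * ((3 * n + 1) * (3 * n).factorial))))
        = 9 * (4 * n + 5) * (n + 1) * (3 * n + 3) * (3 * n + 2) * (3 * n + 1) * P := by
      rw [← hP']; ring
    rw [e1]
    refine lt_of_mul_lt_mul_left (a := 4 * n + 1) ?_ (Nat.zero_le _)
    calc _ = ((4 * n + 1) * (2 * n + 3) * (n + 2) * (4 * (2 * n + 1))) *
              (32 * (2 * n + 1) * (n + 1) ^ 2 * q ^ 2) := by ring
      _ ≤ ((4 * n + 5) * (3 * (3 * n + 2) * (3 * n + 1)) * (n + 1)) *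
              (32 * (2 * n + 1) * (n + 1) ^ 2 * q ^ 2) := Nat.mul_le_mul_right _ key
      _ = ((4 * n + 5) * (3 * (3 * n + 2) * (3 * n + 1)) * (n + 1) ^ 2) *
              (32 * (2 * n + 1) * (n + 1) * q ^ 2) := by ring
      _ < ((4 * n + 5) * (3 * (3 * n + 2) * (3 * n + 1)) * (n + 1) ^ 2) *
              (9 * (4 * n + 1) * P) := Nat.mul_lt_mul_of_pos_left ih (by positivity)
      _ = _ := by ring

theorem choose_ineq (n : ℕ) (hn : 5 ≤ n) :
    32 * (2 * n + 1) * (n + 1) * (4 * n).choose n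
      < 9 * (4 * n + 1) * (4 * n).choose (2 * n) := by
  have hA := Nat.choose_mul_factorial_mul_factorial (show n ≤ 4 * n by omega)
  have hB := Nat.choose_mul_factorial_mul_factorial (show 2 * n ≤ 4 * n by omega)
  rw [show 4 * n - n = 3 * n by omega] at hA
  rw [show 4 * n - 2 * n = 2 * n by omega] at hB
  have h := fact_ineq n hn
  have hBp : 0 < (4 * n).choose (2 * n) := Nat.choose_pos (by omega)
  refine lt_of_mul_lt_mul_right (a := n.factorial * (3 * n).factorial) ?_ (Nat.zero_le _)
  calc _ = 32 * (2 * n + 1) * (n + 1) *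
            ((4 * n).choose n * n.factorial * (3 * n).factorial) := by ring
    _ = (4 * n).choose (2 * n) *
          (32 * (2 * n + 1) * (n + 1) * ((2 * n).factorial) ^ 2) := by
        rw [hA, ← hB]; ring
    _ < (4 * n).choose (2 * n) *
          (9 * (4 * n + 1) * (n.factorial * (3 * n).factorial)) :=
        Nat.mul_lt_mul_of_pos_left h hBp
    _ = _ := by ring

/-- For `n ≥ 5`, `C(4n,n) − C(4n,n−2) + C(4n,n+1) − C(4n,n−1) < C(4n,2n) − C(4n,2n−2)`. -/
theorem stmt_8 (n : ℕ) (hn : 5 ≤ n) :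
    (Nat.choose (4 * n) n : ℤ) - Nat.choose (4 * n) (n - 2) +
        Nat.choose (4 * n) (n + 1) - Nat.choose (4 * n) (n - 1) <
      (Nat.choose (4 * n) (2 * n) : ℤ) - Nat.choose (4 * n) (2 * n - 2) := by
  have h := choose_ineq n hn
  obtain ⟨k, rfl⟩ := Nat.exists_eq_add_of_le' hn
  have a1 := Nat.choose_succ_right_eq (4 * (k + 5)) (k + 5)
  have a2 := Nat.choose_succ_right_eq (4 * (k + 5)) (k + 4)
  have a3 := Nat.choose_succ_right_eq (4 * (k + 5)) (k + 3)
  have b1 := Nat.choose_succ_right_eq (4 * (k + 5)) (2 * k + 9)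
  have b2 := Nat.choose_succ_right_eq (4 * (k + 5)) (2 * k + 8)
  rw [show 4 * (k + 5) - (k + 5) = 3 * k + 15 by omega] at a1
  rw [show 4 * (k + 5) - (k + 4) = 3 * k + 16 by omega] at a2
  rw [show 4 * (k + 5) - (k + 3) = 3 * k + 17 by omega] at a3
  rw [show 4 * (k + 5) - (2 * k + 9) = 2 * k + 11 by omega] at b1
  rw [show 4 * (k + 5) - (2 * k + 8) = 2 * k + 12 by omega] at b2
  rw [show k + 5 - 2 = k + 3 by omega, show k + 5 - 1 = k + 4 by omega,
    show 2 * (k + 5) - 2 = 2 * k + 8 by omega]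
  rw [show 2 * (k + 5) = 2 * k + 10 by ring] at *
  simp only [Nat.add_assoc, Nat.reduceAdd] at *
  generalize (4 * (k + 5)).choose (k + 5) = A at *
  generalize (4 * (k + 5)).choose (k + 6) = A1 at *
  generalize (4 * (k + 5)).choose (k + 4) = A2 at *
  generalize (4 * (k + 5)).choose (k + 3) = A3 at *
  generalize (4 * (k + 5)).choose (2 * k + 10) = B at *
  generalize (4 * (k + 5)).choose (2 * k + 9) = B1 at *
  generalize (4 * (k + 5)).choose (2 * k + 8) = B2 at *
  suffices hq : (A : ℚ) - A3 + A1 - A2 < B - B2 by exact_mod_cast hq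
  have hA : (0 : ℚ) ≤ A := Nat.cast_nonneg _
  have hk : (0 : ℚ) ≤ k := Nat.cast_nonneg _
  qify at h a1 a2 a3 b1 b2
  generalize (k : ℚ) = x at *
  have c1 : (A1 : ℚ) = A * (3 * x + 15) / (x + 6) := by
    rw [eq_div_iff (by positivity)]; linarith
  have c2 : (A2 : ℚ) = A * (x + 5) / (3 * x + 16) := by
    rw [eq_div_iff (by positivity)]; linarith
  have c3 : (A3 : ℚ) = A * ((x + 5) / (3 * x + 16) * ((x + 4) / (3 * x + 17))) := by
    have : (A3 : ℚ) = A2 * (x + 4) / (3 * x + 17) := by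
      rw [eq_div_iff (by positivity)]; linarith
    rw [this, c2]; field_simp
  have d1 : (B1 : ℚ) = B * (2 * x + 10) / (2 * x + 11) := by
    rw [eq_div_iff (by positivity)]; linarith
  have d2 : (B2 : ℚ) = B1 * (2 * x + 9) / (2 * x + 12) := by
    rw [eq_div_iff (by positivity)]; linarith
  have eB : (B : ℚ) - B2 = B * (4 * x + 21) / ((2 * x + 11) * (x + 6)) := by
    rw [d2, d1]; field_simp; ring
  have eA : (A : ℚ) - A3 + A1 - A2 ≤ A * (32 / 9) := by
    have : (A : ℚ) - A3 + A1 - A2 = A * (1 - (x + 5) / (3 * x + 16) * ((x + 4) / (3 * x + 17))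
        + (3 * x + 15) / (x + 6) - (x + 5) / (3 * x + 16)) := by
      rw [c1, c3, c2]; ring
    rw [this]
    refine mul_le_mul_of_nonneg_left ?_ hA
    rw [← sub_nonneg]
    have : 32 / 9 - (1 - (x + 5) / (3 * x + 16) * ((x + 4) / (3 * x + 17))
        + (3 * x + 15) / (x + 6) - (x + 5) / (3 * x + 16))
        = (32 * ((x + 6) * (3 * x + 16) * (3 * x + 17)) - 9 * ((x + 6) * (3 * x + 16) * (3 * x + 17)
          - (x + 5) * (x + 4) * (x + 6) + (3 * x + 15) * (3 * x + 16) * (3 * x + 17)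
          - (x + 5) * (x + 6) * (3 * x + 17))) / (9 * ((x + 6) * (3 * x + 16) * (3 * x + 17))) := by
      field_simp
    rw [this]
    apply div_nonneg _ (by positivity)
    ring_nf
    positivity
  refine lt_of_le_of_lt eA ?_
  rw [eB, lt_div_iff₀ (by positivity)]
  nlinarith [h]
end

section
/- For every integer m ≥ 10, setting j = ⌊m/2⌋, the strict inequality 2m + C(2m,m) − C(2m,m−2) > (C(2m,j) − C(2m,j−2)) + (C(2m,m+1−j) − C(2m,m−1−j)) holds. -/
open Nat in
lemma aux_D (n : ℕ) : (n+1)^2 * (2*(n+1)).choose (n+1) = (2*n+2)*(2*n+1) * (2*n).choose n := by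
  have h := Nat.succ_mul_centralBinom_succ n
  simp only [Nat.centralBinom] at h
  calc _ = (n+1) * ((n+1) * (2*(n+1)).choose (n+1)) := by ring
    _ = _ := by rw [h]; ring

lemma aux_DD (n : ℕ) : (n+1)^2 * (n+2)^2 * (2*(n+2)).choose (n+2)
    = (2*n+4)*(2*n+3)*(2*n+2)*(2*n+1) * (2*n).choose n := by
  have h1 := aux_D n
  have h2 := aux_D (n+1)
  calc _ = (n+1)^2 * ((n+1+1)^2 * (2*(n+1+1)).choose (n+1+1)) := by ring_nf
    _ = (2*(n+1)+2)*(2*(n+1)+1) * ((n+1)^2 * (2*(n+1)).choose (n+1)) := by rw [h2]; ring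
    _ = _ := by rw [h1]; ring

lemma aux_E (a b : ℕ) : (a+1)*(b+1)*(b+2)*(b+3) * (a+b+4).choose (a+1)
    = (a+b+4)*(a+b+3)*(a+b+2)*(a+b+1) * (a+b).choose a := by
  have h1 := Nat.add_choose_mul_factorial_mul_factorial a b
  have h2 := Nat.add_choose_mul_factorial_mul_factorial (a+1) (b+3)
  have e : a+1+(b+3) = a+b+4 := by ring
  rw [e] at h2
  simp only [Nat.factorial_succ] at h2
  rw [← h1] at h2
  have hp : 0 < a.factorial * b.factorial := by positivity
  have s1 := Nat.choose_symm_add (a := a) (b := b)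
  have s2 := Nat.choose_symm_add (a := a+1) (b := b+3)
  rw [e] at s2
  rw [s1, s2]
  apply Nat.eq_of_mul_eq_mul_right hp
  linarith

/-- Comparison of one inductive step. -/
lemma step {p q p' q' D E D' E' x y u v : ℕ} (hx : 0 < x) (hu : 0 < u)
    (hD : x * D' = y * D) (hE : u * E' = v * E) (hq : 0 < q) (hp : 0 < p)
    (ih : q * E ≤ p * D) (hc : q' * v * x * p ≤ p' * y * u * q) : q' * E' ≤ p' * D' := by
  have : (q' * E') * (x * u * p * q) ≤ (p' * D') * (x * u * p * q) := by
    calc _ = q' * x * p * q * (u * E') := by ring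
      _ = (q' * v * x * p) * (q * E) := by rw [hE]; ring
      _ ≤ (p' * y * u * q) * (p * D) := Nat.mul_le_mul hc ih
      _ = p' * u * q * p * (y * D) := by ring
      _ = _ := by rw [← hD]; ring
  exact Nat.le_of_mul_le_mul_right this (by positivity)

lemma even_case (t : ℕ) : (2*(t+6)+1)*(2*(t+6)+2) * (4*(t+6)+1).choose (t+6+1)
    ≤ (8*(t+6)+2) * (2*(2*(t+6))).choose (2*(t+6)) := by
  induction t with
  | zero => decide +kernel
  | succ t ih =>
    have hD := aux_DD (2*(t+6))
    have hE := aux_E (t+6+1) (3*(t+6))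
    rw [show t+6+1+3*(t+6) = 4*(t+6)+1 by ring] at hE
    rw [show 2*(t+1+6) = 2*(t+6)+2 by ring, show 4*(t+1+6)+1 = 4*(t+6)+1+4 by ring,
      show t+1+6+1 = t+6+1+1 by ring]
    generalize (2*(2*(t+6)+2)).choose (2*(t+6)+2) = D' at *
    generalize (2*(2*(t+6))).choose (2*(t+6)) = D at *
    generalize (4*(t+6)+1+4).choose (t+6+1+1) = E' at *
    generalize (4*(t+6)+1).choose (t+6+1) = E at *
    refine step ?_ ?_ hD hE ?_ ?_ ih ?_
    · positivity
    · positivity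
    · positivity
    · positivity
    · ring_nf
      gcongr <;> norm_num

lemma odd_case (t : ℕ) : (2*(t+6)+2)*(2*(t+6)+3) * (4*(t+6)+2).choose (t+6+2)
    ≤ (8*(t+6)+6) * (2*(2*(t+6)+1)).choose (2*(t+6)+1) := by
  induction t with
  | zero => decide +kernel
  | succ t ih =>
    have hD := aux_DD (2*(t+6)+1)
    have hE := aux_E (t+6+2) (3*(t+6))
    rw [show t+6+2+3*(t+6) = 4*(t+6)+2 by ring] at hE
    rw [show 2*(t+1+6)+1 = 2*(t+6)+1+2 by ring, show 4*(t+1+6)+2 = 4*(t+6)+2+4 by ring,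
      show t+1+6+2 = t+6+2+1 by ring]
    generalize (2*(2*(t+6)+1+2)).choose (2*(t+6)+1+2) = D' at *
    generalize (2*(2*(t+6)+1)).choose (2*(t+6)+1) = D at *
    generalize (4*(t+6)+2+4).choose (t+6+2+1) = E' at *
    generalize (4*(t+6)+2).choose (t+6+2) = E at *
    refine step ?_ ?_ hD hE ?_ ?_ ih ?_
    · positivity
    · positivity
    · positivity
    · positivity
    · ring_nf
      gcongr <;> norm_num

lemma mid (n : ℕ) : (n+3)*(n+4) * (2*(n+2)).choose n = (n+2)*(n+1) * (2*(n+2)).choose (n+2) := by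
  have h1 := Nat.choose_succ_right_eq (2*(n+2)) n
  have h2 := Nat.choose_succ_right_eq (2*(n+2)) (n+1)
  rw [show 2*(n+2)-n = n+4 by omega] at h1
  rw [show 2*(n+2)-(n+1) = n+3 by omega] at h2
  calc _ = (n+3) * ((2*(n+2)).choose n * (n+4)) := by ring
    _ = (n+1) * ((2*(n+2)).choose (n+1) * (n+3)) := by rw [← h1]; ring
    _ = _ := by rw [← h2]; ring

lemma final (m E : ℕ) (hm : 2 ≤ m) (h : (m+1)*(m+2)*E ≤ (4*m+2) * (2*m).choose m) :
    (E : ℤ) < 2 * m + (Nat.choose (2 * m) m : ℤ) - Nat.choose (2 * m) (m - 2) := by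
  obtain ⟨n, rfl⟩ := Nat.exists_eq_add_of_le' hm
  have h2 := mid n
  simp only [Nat.add_sub_cancel]
  have : E + (2*(n+2)).choose n ≤ (2*(n+2)).choose (n+2) := by
    have hp : 0 < (n+3)*(n+4) := by positivity
    apply Nat.le_of_mul_le_mul_left _ hp
    rw [mul_add, h2]
    nlinarith
  push_cast
  omega

/-- For `m ≥ 10` and `j = ⌊m/2⌋`:
`2m + C(2m,m) − C(2m,m−2) > (C(2m,j) − C(2m,j−2)) + (C(2m,m+1−j) − C(2m,m−1−j))`. -/
theorem stmt_9 (m : ℕ) (hm : 10 ≤ m) :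
    ((Nat.choose (2 * m) (m / 2) : ℤ) - Nat.choose (2 * m) (m / 2 - 2)) +
        ((Nat.choose (2 * m) (m + 1 - m / 2) : ℤ) - Nat.choose (2 * m) (m - 1 - m / 2)) <
      2 * m + (Nat.choose (2 * m) m : ℤ) - Nat.choose (2 * m) (m - 2) := by
  by_cases h12 : m < 12
  · interval_cases m <;> decide +kernel
  obtain ⟨t, rfl | rfl⟩ : ∃ t, m = 2*(t+6) ∨ m = 2*(t+6)+1 := ⟨m/2-6, by omega⟩
  · have h := final (2*(t+6)) ((4*(t+6)+1).choose (t+6+1)) (by omega)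
      (le_trans (even_case t) (le_of_eq (by ring_nf)))
    rw [Nat.choose_succ_succ] at h
    rw [show 2*(t+6)/2 = t+6 by omega, show 2*(t+6)+1-(t+6) = t+6+1 by omega]
    rw [show 4*(t+6) = 2*(2*(t+6)) by ring] at h
    push_cast at h ⊢
    have := Int.natCast_nonneg ((2*(2*(t+6))).choose (t+6-2))
    have := Int.natCast_nonneg ((2*(2*(t+6))).choose (2*(t+6)-1-(t+6)))
    push_cast at *
    linarith
  · have h := final (2*(t+6)+1) ((4*(t+6)+2).choose (t+6+2)) (by omega)
      (le_trans (odd_case t) (le_of_eq (by ring_nf)))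
    rw [show (2*(t+6)+1)/2 = t+6 by omega, show 2*(t+6)+1+1-(t+6) = t+6+2 by omega,
      show 2*(t+6)+1-1-(t+6) = t+6 by omega]
    rw [show 4*(t+6)+2 = 2*(2*(t+6)+1) by ring] at h
    have := Int.natCast_nonneg ((2*(2*(t+6)+1)).choose (t+6-2))
    push_cast at *
    linarith
end

section
/- Let m ≥ 7 be an integer and define g : ℕ → ℕ by g(i) = [C(2m,i) − C(2m,i−2)] + [C(2m,m+1−i) − C(2m,m−1−i)], where C(a,b) = 0 whenever b < 0 or b > a and [x] = max(x,0) (the differences are computed in ℤ). Then the finite sequence g(0), g(1), …, g(m+1) is not unimodal: there exist indices 0 ≤ a < b < c ≤ m+1 with g(a) > g(b) and g(b) < g(c). -/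
lemma aux_rec (k : ℕ) : (2*k+1)*(2*k+2) * Nat.choose (3*k+3) (k+1)
    = 3*(3*k+2)*(3*k+1) * Nat.choose (3*k) k := by
  have h1 := Nat.add_one_mul_choose_eq (3*k+2) k
  have h2 := Nat.choose_mul_succ_eq (3*k+1) k
  have h3 := Nat.choose_mul_succ_eq (3*k) k
  rw [show 3*k+1+1-k = 2*k+2 by omega] at h2
  rw [show 3*k+1-k = 2*k+1 by omega] at h3
  simp only [show 3*k+2+1 = 3*k+3 by omega, show 3*k+1+1 = 3*k+2 by omega] at h1 h2
  have : (k+1) * ((2*k+1)*(2*k+2) * Nat.choose (3*k+3) (k+1))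
    = (k+1) * (3*(3*k+2)*(3*k+1) * Nat.choose (3*k) k) := by
    zify at *
    linear_combination (-(2*k+1)*(2*k+2) : ℤ) * h1 - (3*k+3)*(2*k+1) * h2 - (3*k+3)*(3*k+2) * h3
  exact Nat.eq_of_mul_eq_mul_left (by omega) this

lemma aux_key (k : ℕ) (hk : 5 ≤ k) :
    (2*k+1) * Nat.choose (2*k) k < Nat.choose (3*k) k := by
  induction k, hk using Nat.le_induction with
  | base => norm_num [Nat.choose_eq_descFactorial_div_factorial, Nat.descFactorial, Nat.factorial]
  | succ k hk ih =>
    have h1 := aux_rec k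
    have h2 := Nat.succ_mul_centralBinom_succ k
    simp only [Nat.centralBinom] at h2
    rw [show 3*(k+1) = 3*k+3 by ring]
    generalize Nat.choose (2*(k+1)) (k+1) = x at *
    generalize Nat.choose (3*k+3) (k+1) = y at *
    generalize Nat.choose (2*k) k = u at *
    generalize Nat.choose (3*k) k = v at *
    have h3 : 2*(2*k+3)*((2*k+1)*2) * v ≤ 3*(3*k+2)*(3*k+1) * v :=
      Nat.mul_le_mul_right _ (by nlinarith)
    have h4 : 2*(2*k+3)*((2*k+1)*2) * ((2*k+1)*u) < 2*(2*k+3)*((2*k+1)*2) * v :=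
      Nat.mul_lt_mul_of_pos_left ih (by positivity)
    have h5 : (2*k+1)*(2*k+2) * ((2*(k+1)+1) * x) < (2*k+1)*(2*k+2) * y := by
      rw [h1]
      refine lt_of_eq_of_lt ?_ (lt_of_lt_of_le h4 h3)
      zify at *
      linear_combination (2*(2*k+1)*(2*k+3) : ℤ) * h2
    exact lt_of_mul_lt_mul_left h5 (Nat.zero_le _)

lemma aux_f (m : ℕ) (hm : 2 ≤ m) :
    ((m:ℤ)+1)*(m+2) * ((Nat.choose (2*m) m : ℤ) - Nat.choose (2*m) (m-2))
      = (4*m+2) * Nat.choose (2*m) m := by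
  obtain ⟨n, rfl⟩ := Nat.exists_eq_add_of_le' hm
  have h1 := Nat.choose_succ_right_eq (2*(n+2)) (n+1)
  have h2 := Nat.choose_succ_right_eq (2*(n+2)) n
  rw [show 2*(n+2) - (n+1) = n+3 by omega] at h1
  rw [show 2*(n+2) - n = n+4 by omega] at h2
  simp only [show n+1+1 = n+2 by omega, Nat.add_sub_cancel] at *
  zify at *
  linear_combination ((n:ℤ)+1) * h1 + (n+3)* h2

lemma aux_even (k : ℕ) (hk : 5 ≤ k) :
    (Nat.choose (4*k) k : ℤ) + Nat.choose (4*k) (k+1)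
      < (Nat.choose (4*k) (2*k) : ℤ) - Nat.choose (4*k) (2*k-2) := by
  have h := aux_key k hk
  have h1 := Nat.choose_mul (n := 4*k) (k := 2*k) (s := k) (by omega)
  have h2 := aux_f (2*k) (by omega)
  have h3 := Nat.choose_succ_right_eq (4*k) k
  rw [show 4*k-k = 3*k by omega] at h1 h3
  rw [show 2*k-k = k by omega] at h1
  rw [show 2*(2*k) = 4*k by ring] at h2
  have hp : 0 < Nat.choose (4*k) k := Nat.choose_pos (by omega)
  have hq : 0 < Nat.choose (2*k) k := Nat.choose_pos (by omega)
  have h4 : (2*k+1) * Nat.choose (4*k) k < Nat.choose (4*k) (2*k) := by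
    apply lt_of_mul_lt_mul_right (a := Nat.choose (2*k) k) _ (Nat.zero_le _)
    rw [h1]
    have := Nat.mul_lt_mul_of_pos_left h hp
    nlinarith
  have h5 : (0:ℤ) < (2*k+1)*(2*k+2) := by positivity
  apply lt_of_mul_lt_mul_left _ h5.le
  push_cast at h2
  zify at h3 h4
  have h6 : ((8:ℤ)*k+2) * ((2*k+1) * Nat.choose (4*k) k) < (8*k+2) * Nat.choose (4*k) (2*k) :=
    mul_lt_mul_of_pos_left h4 (by positivity)
  linear_combination h6 + 2*(2*k+1)*h3 - h2

lemma aux_odd (j : ℕ) (hj : 5 ≤ j) :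
    2 * (Nat.choose (4*j+2) (j+1) : ℤ)
      < (Nat.choose (4*j+2) (2*j+1) : ℤ) - Nat.choose (4*j+2) (2*j-1) := by
  have h := aux_key j hj
  have h1 := Nat.choose_mul (n := 4*j+2) (k := 2*j+1) (s := j+1) (by omega)
  have h2 := aux_f (2*j+1) (by omega)
  rw [show 4*j+2-(j+1) = 3*j+1 by omega, show 2*j+1-(j+1) = j by omega] at h1
  rw [show 2*(2*j+1) = 4*j+2 by ring, show 2*j+1-2 = 2*j-1 by omega] at h2
  have h3 := Nat.add_one_mul_choose_eq (2*j) j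
  have h4 := Nat.choose_mul_succ_eq (3*j) j
  rw [show 3*j+1-j = 2*j+1 by omega] at h4
  have hp : 0 < Nat.choose (4*j+2) (j+1) := Nat.choose_pos (by omega)
  have h5 : (2*j+2)*(2*j+3) * Nat.choose (2*j+1) (j+1) < (4*j+3) * Nat.choose (3*j+1) j := by
    apply lt_of_mul_lt_mul_left (a := 2*j+1) _ (Nat.zero_le _)
    have e1 : 2*(2*j+1)*(2*j+3) * ((2*j+1) * Nat.choose (2*j) j)
        < 2*(2*j+1)*(2*j+3) * Nat.choose (3*j) j := Nat.mul_lt_mul_of_pos_left h (by positivity)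
    have e2 : 2*(2*j+1)*(2*j+3) * Nat.choose (3*j) j ≤ (4*j+3)*(3*j+1) * Nat.choose (3*j) j :=
      Nat.mul_le_mul_right _ (by nlinarith)
    zify at *
    linear_combination e1 + e2 - (2*(2*j+1)*(2*j+3):ℤ)*h3 + (4*j+3)*h4
  have h6 : (2*j+2)*(2*j+3) * Nat.choose (4*j+2) (j+1) < (4*j+3) * Nat.choose (4*j+2) (2*j+1) := by
    apply lt_of_mul_lt_mul_right (a := Nat.choose (2*j+1) (j+1)) _ (Nat.zero_le _)
    have := Nat.mul_lt_mul_of_pos_left h5 hp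
    zify at *
    linear_combination this - (4*j+3:ℤ)*h1
  have h7 : (0:ℤ) < (2*j+2)*(2*j+3) := by positivity
  apply lt_of_mul_lt_mul_left _ h7.le
  push_cast at h2
  zify at h6
  linear_combination 2*h6 - h2

/-- Non-unimodality of the h-vector of the idealization `A` of Theorem 4.3: for `m ≥ 7`,
with `g i = [C(2m,i) − C(2m,i−2)] + [C(2m,m+1−i) − C(2m,m−1−i)]` (where `C(a,b) = 0`
for `b < 0` or `b > a`, differences computed in `ℤ`, `[x] = max(x,0)`), the sequence
`g 0, g 1, …, g (m+1)` is not unimodal: there are `a < b < c ≤ m+1` with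
`g b < g a` and `g b < g c`. -/
theorem stmt_11 (m : ℕ) (hm : 7 ≤ m) (g : ℕ → ℕ)
    (hg : ∀ i : ℕ, (g i : ℤ) =
      max ((Nat.choose (2 * m) i : ℤ) -
          (if 2 ≤ i then (Nat.choose (2 * m) (i - 2) : ℤ) else 0)) 0 +
      max ((if i ≤ m + 1 then (Nat.choose (2 * m) (m + 1 - i) : ℤ) else 0) -
          (if i ≤ m - 1 then (Nat.choose (2 * m) (m - 1 - i) : ℤ) else 0)) 0) :
    ∃ a b c : ℕ, a < b ∧ b < c ∧ c ≤ m + 1 ∧ g b < g a ∧ g b < g c := by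
  by_cases h10 : m < 10
  · interval_cases m
    · refine ⟨2, 4, 6, by norm_num, by norm_num, by norm_num, ?_, ?_⟩ <;>
      · zify
        rw [hg, hg]
        norm_num [Nat.choose_eq_descFactorial_div_factorial, Nat.descFactorial, Nat.factorial]
    · refine ⟨2, 4, 7, by norm_num, by norm_num, by norm_num, ?_, ?_⟩ <;>
      · zify
        rw [hg, hg]
        norm_num [Nat.choose_eq_descFactorial_div_factorial, Nat.descFactorial, Nat.factorial]
    · refine ⟨2, 5, 8, by norm_num, by norm_num, by norm_num, ?_, ?_⟩ <;>
      · zify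
        rw [hg, hg]
        norm_num [Nat.choose_eq_descFactorial_div_factorial, Nat.descFactorial, Nat.factorial]
  have g1 : (Nat.choose (2*m) m : ℤ) - Nat.choose (2*m) (m-2) ≤ g 1 := by
    rw [hg 1, if_pos (by omega : 1 ≤ m + 1), if_pos (by omega : 1 ≤ m - 1),
      show m + 1 - 1 = m by omega, show m - 1 - 1 = m - 2 by omega]
    exact le_add_of_nonneg_of_le (le_max_right _ _) (le_max_left _ _)
  have gm : (Nat.choose (2*m) m : ℤ) - Nat.choose (2*m) (m-2) ≤ g m := by
    rw [hg m, if_pos (by omega : 2 ≤ m)]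
    exact le_add_of_le_of_nonneg (le_max_left _ _) (le_max_right _ _)
  have gb : ∀ b, b ≤ m + 1 → (g b : ℤ) ≤ Nat.choose (2*m) b + Nat.choose (2*m) (m+1-b) := by
    intro b hb
    rw [hg b, if_pos hb]
    apply add_le_add <;> apply max_le <;> first | positivity | skip
    all_goals
      apply sub_le_self
      split_ifs <;> positivity
  rcases Nat.even_or_odd' m with ⟨k, rfl | rfl⟩
  · have h := aux_even k (by omega)
    have hb := gb k (by omega)
    rw [show 2*k+1-k = k+1 by omega] at hb
    rw [show 2*(2*k) = 4*k by ring] at *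
    exact ⟨1, k, 2*k, by omega, by omega, by omega, by omega, by omega⟩
  · have h := aux_odd k (by omega)
    have hb := gb (k+1) (by omega)
    rw [show 2*k+1+1-(k+1) = k+1 by omega] at hb
    rw [show 2*(2*k+1) = 4*k+2 by ring] at *
    rw [show 2*k+1-2 = 2*k-1 by omega] at g1 gm
    exact ⟨1, k+1, 2*k+1, by omega, by omega, by omega, by omega, by omega⟩
end

section
/- Let k be a field of characteristic 0, let S = k[u,x,y,z], and let I = (x^2+yz+u^2, xu, x^2+xy, xz+yu, zu+u^2, y^2+z^2). Then: the degree-1 component of S/I has k-dimension 4 (i.e., I contains no nonzero linear form), the degree-2 component of S/I has k-dimension 4, the degree-3 component of S/I is zero, and moreover no nonzero element of the degree-1 component of S/I annihilates all of u, x, y, z in S/I (i.e., the socle of S/I is concentrated in degree 2). -/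
open MvPolynomial

/-- Constant coefficient of the second partial derivative. -/
noncomputable def dd {k : Type} [Field k] (a b : Fin 4) (p : MvPolynomial (Fin 4) k) : k :=
  constantCoeff (pderiv a (pderiv b p))

noncomputable def d1 {k : Type} [Field k] (a : Fin 4) (p : MvPolynomial (Fin 4) k) : k :=
  constantCoeff (pderiv a p)

theorem dd_mul {k : Type} [Field k] (a b : Fin 4) (p q : MvPolynomial (Fin 4) k) :
    dd a b (p * q) = dd a b p * constantCoeff q + d1 b p * d1 a q
      + d1 a p * d1 b q + constantCoeff p * dd a b q := by
  simp only [dd, d1, Derivation.leibniz, map_add, map_mul, smul_eq_mul]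
  ring

theorem d1_mul {k : Type} [Field k] (a : Fin 4) (p q : MvPolynomial (Fin 4) k) :
    d1 a (p * q) = d1 a p * constantCoeff q + constantCoeff p * d1 a q := by
  simp only [d1, Derivation.leibniz, map_add, map_mul, smul_eq_mul]
  ring

theorem dd_add {k : Type} [Field k] (a b : Fin 4) (p q : MvPolynomial (Fin 4) k) :
    dd a b (p + q) = dd a b p + dd a b q := by
  simp [dd]

theorem d1_add {k : Type} [Field k] (a : Fin 4) (p q : MvPolynomial (Fin 4) k) :
    d1 a (p + q) = d1 a p + d1 a q := by
  simp [d1]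

theorem d1_X {k : Type} [Field k] (a b : Fin 4) :
    d1 a (X b : MvPolynomial (Fin 4) k) = if b = a then 1 else 0 := by
  by_cases h : b = a
  · subst h; simp [d1]
  · simp [d1, h, pderiv_X_of_ne h]

theorem dd_X {k : Type} [Field k] (a b c : Fin 4) :
    dd a b (X c : MvPolynomial (Fin 4) k) = 0 := by
  by_cases h : c = b
  · subst h; simp [dd]
  · simp [dd, pderiv_X_of_ne h]

theorem d1_C {k : Type} [Field k] (a : Fin 4) (c : k) :
    d1 a (C c : MvPolynomial (Fin 4) k) = 0 := by
  simp [d1]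

theorem dd_C {k : Type} [Field k] (a b : Fin 4) (c : k) :
    dd a b (C c : MvPolynomial (Fin 4) k) = 0 := by
  simp [dd]

/-- Linear functionals vanishing on the ideal. -/
def Van {k : Type} [Field k] (p : MvPolynomial (Fin 4) k) : Prop :=
  constantCoeff p = 0 ∧ (∀ a, d1 a p = 0) ∧
  dd 0 0 p - 2 * dd 0 3 p - 2 * dd 2 3 p = 0 ∧
  dd 0 2 p - dd 1 3 p = 0 ∧
  dd 1 1 p - 2 * dd 1 2 p - 2 * dd 2 3 p = 0 ∧
  dd 3 3 p - dd 2 2 p = 0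

theorem van_of_mem {k : Type} [Field k] (p : MvPolynomial (Fin 4) k)
    (hp : p ∈ Ideal.span
      ({X 1 ^ 2 + X 2 * X 3 + X 0 ^ 2, X 1 * X 0, X 1 ^ 2 + X 1 * X 2,
        X 1 * X 3 + X 2 * X 0, X 3 * X 0 + X 0 ^ 2, X 2 ^ 2 + X 3 ^ 2} :
        Set (MvPolynomial (Fin 4) k))) : Van p := by
  induction hp using Submodule.span_induction with
  | mem x hx =>
    simp only [Set.mem_insert_iff, Set.mem_singleton_iff] at hx
    rcases hx with rfl | rfl | rfl | rfl | rfl | rfl <;>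
    · refine ⟨by simp [pow_two], fun a => by simp [pow_two, d1_add, d1_mul], ?_, ?_, ?_, ?_⟩ <;>
        simp [pow_two, dd_add, dd_mul, d1_X, dd_X] <;> try ring
  | zero => simp [Van, d1, dd]
  | add x y _ _ hx hy =>
    obtain ⟨h0, h1, h2, h3, h4, h5⟩ := hx
    obtain ⟨g0, g1, g2, g3, g4, g5⟩ := hy
    refine ⟨by simp [h0, g0], fun a => by simp [d1_add, h1, g1], ?_, ?_, ?_, ?_⟩ <;>
      simp only [dd_add]
    · linear_combination h2 + g2
    · linear_combination h3 + g3
    · linear_combination h4 + g4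
    · linear_combination h5 + g5
  | smul q x _ hx =>
    obtain ⟨h0, h1, h2, h3, h4, h5⟩ := hx
    refine ⟨by simp [h0], fun a => by simp [d1_mul, h1, h0], ?_, ?_, ?_, ?_⟩ <;>
      simp only [smul_eq_mul, dd_mul, h0, h1]
    · linear_combination constantCoeff q * h2
    · linear_combination constantCoeff q * h3
    · linear_combination constantCoeff q * h4
    · linear_combination constantCoeff q * h5

theorem deg2_mem {k R : Type} [Field k] [CommRing R] [Algebra k R] (W : Submodule k R)
    (v : Fin 4 → R)
    (r1 : v 1 ^ 2 + v 2 * v 3 + v 0 ^ 2 = 0) (r2 : v 1 * v 0 = 0)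
    (r3 : v 1 ^ 2 + v 1 * v 2 = 0) (r4 : v 1 * v 3 + v 2 * v 0 = 0)
    (r5 : v 3 * v 0 + v 0 ^ 2 = 0) (r6 : v 2 ^ 2 + v 3 ^ 2 = 0)
    (hA : v 0 * v 0 ∈ W) (hB : v 0 * v 2 ∈ W) (hC : v 1 * v 1 ∈ W) (hD : v 3 * v 3 ∈ W)
    (i j : Fin 4) : v i * v j ∈ W := by
  have h01 : v 0 * v 1 ∈ W := by
    have : v 0 * v 1 = 0 := by linear_combination r2
    rw [this]; exact W.zero_mem
  have h03 : v 0 * v 3 ∈ W := by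
    have : v 0 * v 3 = -(v 0 * v 0) := by linear_combination r5
    rw [this]; exact W.neg_mem hA
  have h12 : v 1 * v 2 ∈ W := by
    have : v 1 * v 2 = -(v 1 * v 1) := by linear_combination r3
    rw [this]; exact W.neg_mem hC
  have h13 : v 1 * v 3 ∈ W := by
    have : v 1 * v 3 = -(v 0 * v 2) := by linear_combination r4
    rw [this]; exact W.neg_mem hB
  have h22 : v 2 * v 2 ∈ W := by
    have : v 2 * v 2 = -(v 3 * v 3) := by linear_combination r6
    rw [this]; exact W.neg_mem hD
  have h23 : v 2 * v 3 ∈ W := by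
    have : v 2 * v 3 = -(v 1 * v 1 + v 0 * v 0) := by linear_combination r1
    rw [this]; exact W.neg_mem (W.add_mem hC hA)
  fin_cases i <;> fin_cases j <;> first | assumption | (rw [mul_comm]; assumption)

theorem deg3_zero {R : Type} [CommRing R] (v : Fin 4 → R)
    (r1 : v 1 ^ 2 + v 2 * v 3 + v 0 ^ 2 = 0) (r2 : v 1 * v 0 = 0)
    (r3 : v 1 ^ 2 + v 1 * v 2 = 0) (r4 : v 1 * v 3 + v 2 * v 0 = 0)
    (r5 : v 3 * v 0 + v 0 ^ 2 = 0) (r6 : v 2 ^ 2 + v 3 ^ 2 = 0)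
    (i j l : Fin 4) : v i * v j * v l = 0 := by
  generalize hu : v 0 = u at *
  generalize hx : v 1 = x at *
  generalize hy : v 2 = y at *
  generalize hz : v 3 = z at *
  have a1 : x ^ 2 * z = 0 := by linear_combination x * r4 - y * r2
  have a2 : y ^ 2 * u = 0 := by linear_combination y * r4 - z * r3 + a1
  have a3 : z ^ 2 * u = 0 := by linear_combination u * r6 - a2
  have a4 : u ^ 3 = 0 := by linear_combination a3 - z * r5 + u * r5
  have a5 : u ^ 2 * z = 0 := by linear_combination u * r5 - a4
  have a6 : x ^ 2 * y = 0 := by linear_combination -x * r1 + u * r2 + x * r3 + z * r3 - a1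
  have a7 : x ^ 3 = 0 := by linear_combination x * r3 - a6
  have a8 : y * z * u = 0 := by linear_combination u * r1 - a4 - x * r2
  have a9 : y * u ^ 2 = 0 := by linear_combination y * r5 - a8
  have b1 : x * z ^ 2 = 0 := by linear_combination z * r4 - a8
  have b2 : y * z ^ 2 = 0 := by linear_combination z * r1 - a1 - a5
  have b3 : y ^ 2 * z = 0 := by linear_combination y * r1 - a6 - a9
  have b4 : z ^ 3 = 0 := by linear_combination z * r6 - b3
  have b5 : y ^ 3 = 0 := by linear_combination y * r6 - b2
  have b6 : x * y * z = 0 := by linear_combination z * r3 - a1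
  have b7 : x * y ^ 2 = 0 := by linear_combination y * r3 - a6
  fin_cases i <;> fin_cases j <;> fin_cases l <;> simp only [Fin.zero_eta, Fin.mk_one, Fin.reduceFinMk, hu, hx, hy, hz] <;> grind


/-- Theorem 3.1 (properties of the base ring): over a field `k` of characteristic `0`,
with `S = k[u,x,y,z]` (variables `u = X 0`, `x = X 1`, `y = X 2`, `z = X 3`) and
`I = (x²+yz+u², xu, x²+xy, xz+yu, zu+u², y²+z²)`, the quotient `S/I` has
`dim_k (S/I)_1 = 4`, `dim_k (S/I)_2 = 4`, `(S/I)_3 = 0`, and no nonzero element of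
`(S/I)_1` annihilates all of `u,x,y,z`, i.e. the socle of `S/I` is concentrated in
degree `2`; so `S/I` is Artinian with h-vector `(1,4,4)`, regularity `2`, and level
of type `4`. -/
theorem stmt_12 (k : Type) [Field k] [CharZero k]
    (I : Ideal (MvPolynomial (Fin 4) k))
    (hI : I = Ideal.span
      ({X 1 ^ 2 + X 2 * X 3 + X 0 ^ 2, X 1 * X 0, X 1 ^ 2 + X 1 * X 2,
        X 1 * X 3 + X 2 * X 0, X 3 * X 0 + X 0 ^ 2, X 2 ^ 2 + X 3 ^ 2} :
        Set (MvPolynomial (Fin 4) k))) :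
    Module.finrank k
        (Submodule.map (Ideal.Quotient.mkₐ k I).toLinearMap
          (homogeneousSubmodule (Fin 4) k 1)) = 4 ∧
    Module.finrank k
        (Submodule.map (Ideal.Quotient.mkₐ k I).toLinearMap
          (homogeneousSubmodule (Fin 4) k 2)) = 4 ∧
    Submodule.map (Ideal.Quotient.mkₐ k I).toLinearMap
        (homogeneousSubmodule (Fin 4) k 3) = ⊥ ∧
    (∀ a : MvPolynomial (Fin 4) k ⧸ I,
      a ∈ Submodule.map (Ideal.Quotient.mkₐ k I).toLinearMap
          (homogeneousSubmodule (Fin 4) k 1) →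
      (∀ j : Fin 4, a * Ideal.Quotient.mk I (X j) = 0) → a = 0) := by
  have key : ∀ p : MvPolynomial (Fin 4) k, Ideal.Quotient.mk I p = 0 → Van p := by
    intro p hp
    rw [Ideal.Quotient.eq_zero_iff_mem, hI] at hp
    exact van_of_mem p hp
  have rel : ∀ p ∈ ({X 1 ^ 2 + X 2 * X 3 + X 0 ^ 2, X 1 * X 0, X 1 ^ 2 + X 1 * X 2,
        X 1 * X 3 + X 2 * X 0, X 3 * X 0 + X 0 ^ 2, X 2 ^ 2 + X 3 ^ 2} :
        Set (MvPolynomial (Fin 4) k)), Ideal.Quotient.mk I p = 0 := by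
    intro p hp
    rw [Ideal.Quotient.eq_zero_iff_mem, hI]
    exact Ideal.subset_span hp
  simp only [Set.mem_insert_iff, Set.mem_singleton_iff, forall_eq_or_imp, forall_eq,
    map_add, map_mul, map_pow] at rel
  have lin : ∀ p : MvPolynomial (Fin 4) k, ∀ c : k,
      c • Ideal.Quotient.mk I p = Ideal.Quotient.mk I (C c * p) := by
    intro p c
    rw [← smul_eq_C_mul]
    exact (map_smul (Ideal.Quotient.mkₐ k I) c p).symm
  have hX : ∀ i, (Ideal.Quotient.mkₐ k I) (X i) = Ideal.Quotient.mk I (X i) := fun i => rfl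
  have m1 : Submodule.map (Ideal.Quotient.mkₐ k I).toLinearMap
      (homogeneousSubmodule (Fin 4) k 1) =
      Submodule.span k (Set.range fun i => Ideal.Quotient.mk I (X i)) := by
    rw [homogeneousSubmodule_one_eq_span_X, Submodule.map_span, ← Set.range_comp]
    rfl
  have mS : ∀ n, Submodule.map (Ideal.Quotient.mkₐ k I).toLinearMap
      (homogeneousSubmodule (Fin 4) k n) =
      (Submodule.span k (Set.range fun i => Ideal.Quotient.mk I (X i))) ^ n := by
    intro n
    rw [← m1, ← homogeneousSubmodule_one_pow, Submodule.map_pow]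
  obtain ⟨r1, r2, r3, r4, r5, r6⟩ := rel
  have m2 : Submodule.map (Ideal.Quotient.mkₐ k I).toLinearMap
      (homogeneousSubmodule (Fin 4) k 2) =
      Submodule.span k (Set.range ![Ideal.Quotient.mk I (X 0 * X 0),
        Ideal.Quotient.mk I (X 0 * X 2), Ideal.Quotient.mk I (X 1 * X 1),
        Ideal.Quotient.mk I (X 3 * X 3)]) := by
    rw [mS, Submodule.pow_succ, Submodule.pow_one, Submodule.span_mul_span]
    apply le_antisymm
    · rw [Submodule.span_le]
      rintro _ ⟨_, ⟨i, rfl⟩, _, ⟨j, rfl⟩, rfl⟩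
      simp only [SetLike.mem_coe]
      generalize hW : Submodule.span k (Set.range ![Ideal.Quotient.mk I (X 0 * X 0),
        Ideal.Quotient.mk I (X 0 * X 2), Ideal.Quotient.mk I (X 1 * X 1),
        Ideal.Quotient.mk I (X 3 * X 3)]) = W
      have hA : Ideal.Quotient.mk I (X 0) * Ideal.Quotient.mk I (X 0) ∈ W := by
        rw [← hW, ← map_mul]; exact Submodule.subset_span ⟨0, rfl⟩
      have hB : Ideal.Quotient.mk I (X 0) * Ideal.Quotient.mk I (X 2) ∈ W := by
        rw [← hW, ← map_mul]; exact Submodule.subset_span ⟨1, rfl⟩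
      have hC : Ideal.Quotient.mk I (X 1) * Ideal.Quotient.mk I (X 1) ∈ W := by
        rw [← hW, ← map_mul]; exact Submodule.subset_span ⟨2, rfl⟩
      have hD : Ideal.Quotient.mk I (X 3) * Ideal.Quotient.mk I (X 3) ∈ W := by
        rw [← hW, ← map_mul]; exact Submodule.subset_span ⟨3, rfl⟩
      exact deg2_mem W (fun i => Ideal.Quotient.mk I (X i)) r1 r2 r3 r4 r5 r6 hA hB hC hD i j
    · rw [Submodule.span_le]
      rintro _ ⟨i, rfl⟩
      apply Submodule.subset_span
      fin_cases i
      · exact ⟨_, ⟨0, rfl⟩, _, ⟨0, rfl⟩, (map_mul _ _ _).symm⟩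
      · exact ⟨_, ⟨0, rfl⟩, _, ⟨2, rfl⟩, (map_mul _ _ _).symm⟩
      · exact ⟨_, ⟨1, rfl⟩, _, ⟨1, rfl⟩, (map_mul _ _ _).symm⟩
      · exact ⟨_, ⟨3, rfl⟩, _, ⟨3, rfl⟩, (map_mul _ _ _).symm⟩
  refine ⟨?_, ?_, ?_, ?_⟩
  · rw [m1, finrank_span_eq_card]
    · simp
    · rw [Fintype.linearIndependent_iff]
      intro g hg
      simp only [Fin.sum_univ_four, lin, ← map_add] at hg
      have h := (key _ hg).2.1
      intro i
      have hi := h i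
      simp only [d1_add, d1_mul, d1_X, d1_C, constantCoeff_C, constantCoeff_X] at hi
      fin_cases i <;> simpa using hi
  · rw [m2, finrank_span_eq_card]
    · simp
    · rw [Fintype.linearIndependent_iff]
      intro g hg
      simp [Fin.sum_univ_four, -map_mul, -map_add, lin] at hg
      simp only [← map_add] at hg
      obtain ⟨-, -, h2, h3, h4, h5⟩ := key _ hg
      simp [dd_add, dd_mul, d1_mul, d1_X, d1_C, dd_X, dd_C, ← two_mul] at h2 h3 h4 h5
      intro i
      fin_cases i <;> simp [*]
  · rw [mS, Submodule.pow_succ, Submodule.pow_succ, Submodule.pow_one, Submodule.span_mul_span, Submodule.span_mul_span,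
      Submodule.span_eq_bot]
    rintro _ ⟨_, ⟨_, ⟨i, rfl⟩, _, ⟨j, rfl⟩, rfl⟩, _, ⟨l, rfl⟩, rfl⟩
    exact deg3_zero (fun i => Ideal.Quotient.mk I (X i)) r1 r2 r3 r4 r5 r6 i j l
  · intro a ha hj
    rw [m1, Submodule.mem_span_range_iff_exists_fun] at ha
    obtain ⟨g, rfl⟩ := ha
    simp only [Fin.sum_univ_four, lin, ← map_add, ← map_mul] at hj ⊢
    obtain ⟨-, -, h2, h3, h4, h5⟩ := key _ (hj 0)
    obtain ⟨-, -, g2, g3, g4, g5⟩ := key _ (hj 1)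
    simp [dd_add, dd_mul, d1_add, d1_mul, d1_X, d1_C, dd_X, dd_C, ← two_mul] at h2 h3 h4 h5 g2 g3 g4 g5
    have e0 : g 0 = 0 := by linear_combination h2 / 2 + g3
    have e1 : g 1 = 0 := by linear_combination g4 / 2 + h3
    simp [e0, e1, h3, g3]
end

section
/- Let k be a field of characteristic 0 and let α ≥ 2 be an integer. Let S = k[u,v,w,x,y,z] and let I = (x^2, xy, y^2, yz, z^2, zu, u^2, uv, v^2, vw, w^2, xz + α·zw − uw, zw + xu + (α−2)·uw). Then the degree-1 component of S/I has k-dimension 6, the degree-2 component of S/I has k-dimension 8, and the degree-3 component of S/I is zero; that is, S/I is Artinian with Hilbert series 1 + 6t + 8t^2. -/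
open MvPolynomial
open scoped Pointwise

lemma roos_aux (k : Type) [Field k] (α : ℕ)
    (I : Ideal (MvPolynomial (Fin 6) k))
    (hI : I = Ideal.span
      ({X 3 ^ 2, X 3 * X 4, X 4 ^ 2, X 4 * X 5, X 5 ^ 2, X 5 * X 0, X 0 ^ 2,
        X 0 * X 1, X 1 ^ 2, X 1 * X 2, X 2 ^ 2,
        X 3 * X 5 + (α : MvPolynomial (Fin 6) k) * (X 5 * X 2) - X 0 * X 2,
        X 5 * X 2 + X 3 * X 0 +
          ((α : MvPolynomial (Fin 6) k) - 2) * (X 0 * X 2)} :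
        Set (MvPolynomial (Fin 6) k)))
    (d : Fin 6 → Fin 6 → MvPolynomial (Fin 6) k → k)
    (hd : d = fun i j p => constantCoeff (pderiv i (pderiv j p)))
    (p : MvPolynomial (Fin 6) k) (hp : p ∈ I) :
    constantCoeff p = 0 ∧ (∀ i, constantCoeff (pderiv i p) = 0) ∧
    d 0 2 p + d 3 5 p - (α - 2) * d 3 0 p = 0 ∧
    d 5 2 p - α * d 3 5 p - d 3 0 p = 0 ∧
    d 0 4 p = 0 ∧ d 1 3 p = 0 ∧ d 1 4 p = 0 ∧ d 1 5 p = 0 ∧ d 2 3 p = 0 ∧ d 2 4 p = 0 := by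
  have e2 : constantCoeff (σ := Fin 6) (R := k) (2 : MvPolynomial (Fin 6) k) = 2 := map_ofNat _ 2
  have p2 : ∀ i : Fin 6, pderiv i (2 : MvPolynomial (Fin 6) k) = 0 :=
    fun i => Derivation.map_natCast (pderiv i) 2
  have pa : ∀ i : Fin 6, pderiv i (α : MvPolynomial (Fin 6) k) = 0 :=
    fun i => Derivation.map_natCast (pderiv i) α
  rw [hI] at hp
  subst hd
  beta_reduce
  induction hp using Submodule.span_induction with
  | mem x hx =>
    simp only [Set.mem_insert_iff, Set.mem_singleton_iff] at hx
    rcases hx with h | h | h | h | h | h | h | h | h | h | h | h | h <;> subst h <;>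
      refine ⟨by simp, fun i => ?_, ?_⟩ <;> try fin_cases i
    all_goals
      simp [pderiv_X, Pi.single_apply, Derivation.leibniz, Derivation.leibniz_pow, e2, p2, pa]
  | zero => simp
  | add x y _ _ hx hy =>
    obtain ⟨a0, a1, b1, b2, b3, b4, b5, b6, b7, b8⟩ := hx
    obtain ⟨a0', a1', c1, c2, c3, c4, c5, c6, c7, c8⟩ := hy
    refine ⟨by simp [a0, a0'], fun i => by simp [a1, a1'], ?_, ?_, ?_, ?_, ?_, ?_, ?_, ?_⟩ <;>
      simp only [map_add]
    · linear_combination b1 + c1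
    · linear_combination b2 + c2
    · linear_combination b3 + c3
    · linear_combination b4 + c4
    · linear_combination b5 + c5
    · linear_combination b6 + c6
    · linear_combination b7 + c7
    · linear_combination b8 + c8
  | smul a x _ hx =>
    obtain ⟨a0, a1, b1, b2, b3, b4, b5, b6, b7, b8⟩ := hx
    have key : ∀ i j, constantCoeff (pderiv i (pderiv j (a * x))) =
        constantCoeff a * constantCoeff (pderiv i (pderiv j x)) := by
      intro i j
      simp [Derivation.leibniz, a0, a1]
    refine ⟨by simp [a0], fun i => by simp [Derivation.leibniz, a0, a1], ?_⟩
    simp only [smul_eq_mul, key]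
    refine ⟨?_, ?_, ?_, ?_, ?_, ?_, ?_, ?_⟩
    · linear_combination constantCoeff a * b1
    · linear_combination constantCoeff a * b2
    · linear_combination constantCoeff a * b3
    · linear_combination constantCoeff a * b4
    · linear_combination constantCoeff a * b5
    · linear_combination constantCoeff a * b6
    · linear_combination constantCoeff a * b7
    · linear_combination constantCoeff a * b8

lemma roos_mem (k A : Type) [Field k] [CommRing A] [Algebra k A] (α : ℕ) (q : Fin 6 → A)
    (g1 : q 3 ^ 2 = 0) (g2 : q 3 * q 4 = 0) (g3 : q 4 ^ 2 = 0) (g4 : q 4 * q 5 = 0)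
    (g5 : q 5 ^ 2 = 0) (g6 : q 5 * q 0 = 0) (g7 : q 0 ^ 2 = 0) (g8 : q 0 * q 1 = 0)
    (g9 : q 1 ^ 2 = 0) (g10 : q 1 * q 2 = 0) (g11 : q 2 ^ 2 = 0)
    (g12 : q 3 * q 5 + (α : A) * (q 5 * q 2) - q 0 * q 2 = 0)
    (g13 : q 5 * q 2 + q 3 * q 0 + ((α : A) - 2) * (q 0 * q 2) = 0)
    (b : Fin 8 → A)
    (hb' : b = ![q 0 * q 2, q 5 * q 2, q 0 * q 4, q 1 * q 3, q 1 * q 4, q 1 * q 5,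
      q 2 * q 3, q 2 * q 4]) (i j : Fin 6) :
    q i * q j ∈ Submodule.span k (Set.range b) := by
  have hb : ∀ n, b n ∈ Submodule.span k (Set.range b) :=
    fun n => Submodule.subset_span ⟨n, rfl⟩
  have h35 : q 3 * q 5 = b 0 - (α : k) • b 1 := by
    simp only [hb', Matrix.cons_val, Algebra.smul_def, map_natCast]
    linear_combination g12
  have h30 : q 3 * q 0 = - b 1 - ((α : k) - 2) • b 0 := by
    simp only [hb', Matrix.cons_val, Algebra.smul_def, map_natCast, map_sub, map_ofNat]
    linear_combination g13
  have m35 : q 3 * q 5 ∈ Submodule.span k (Set.range b) := by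
    rw [h35]; exact sub_mem (hb 0) (Submodule.smul_mem _ _ (hb 1))
  have m30 : q 3 * q 0 ∈ Submodule.span k (Set.range b) := by
    rw [h30]; exact sub_mem (neg_mem (hb 1)) (Submodule.smul_mem _ _ (hb 0))
  have m0 : ∀ t, t = 0 → t ∈ Submodule.span k (Set.range b) := by
    rintro t rfl; exact zero_mem _
  have b0 : q 0 * q 2 ∈ Submodule.span k (Set.range b) := by
    have := hb 0; rw [hb'] at this ⊢; exact this
  have b1 : q 5 * q 2 ∈ Submodule.span k (Set.range b) := by
    have := hb 1; rw [hb'] at this ⊢; exact this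
  have b2 : q 0 * q 4 ∈ Submodule.span k (Set.range b) := by
    have := hb 2; rw [hb'] at this ⊢; exact this
  have b3 : q 1 * q 3 ∈ Submodule.span k (Set.range b) := by
    have := hb 3; rw [hb'] at this ⊢; exact this
  have b4 : q 1 * q 4 ∈ Submodule.span k (Set.range b) := by
    have := hb 4; rw [hb'] at this ⊢; exact this
  have b5 : q 1 * q 5 ∈ Submodule.span k (Set.range b) := by
    have := hb 5; rw [hb'] at this ⊢; exact this
  have b6 : q 2 * q 3 ∈ Submodule.span k (Set.range b) := by
    have := hb 6; rw [hb'] at this ⊢; exact this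
  have b7 : q 2 * q 4 ∈ Submodule.span k (Set.range b) := by
    have := hb 7; rw [hb'] at this ⊢; exact this
  have hle : ∀ i j, i ≤ j → q i * q j ∈ Submodule.span k (Set.range b) := by
    intro i j hij
    fin_cases i <;> fin_cases j <;> first
      | exact absurd hij (by decide)
      | assumption
      | (rw [mul_comm]; assumption)
      | (apply m0; first
          | (rw [← sq]; assumption)
          | assumption
          | (rw [mul_comm]; assumption))
  rcases le_total i j with h | h
  · exact hle i j h
  · rw [mul_comm]; exact hle j i h

lemma roos_triple (A : Type) [CommRing A] (α : ℕ) (q : Fin 6 → A)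
    (g1 : q 3 ^ 2 = 0) (g2 : q 3 * q 4 = 0) (g3 : q 4 ^ 2 = 0) (g4 : q 4 * q 5 = 0)
    (g5 : q 5 ^ 2 = 0) (g6 : q 5 * q 0 = 0) (g7 : q 0 ^ 2 = 0) (g8 : q 0 * q 1 = 0)
    (g9 : q 1 ^ 2 = 0) (g10 : q 1 * q 2 = 0) (g11 : q 2 ^ 2 = 0)
    (g12 : q 3 * q 5 + (α : A) * (q 5 * q 2) - q 0 * q 2 = 0)
    (g13 : q 5 * q 2 + q 3 * q 0 + ((α : A) - 2) * (q 0 * q 2) = 0)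
    (b : Fin 8 → A)
    (hb' : b = ![q 0 * q 2, q 5 * q 2, q 0 * q 4, q 1 * q 3, q 1 * q 4, q 1 * q 5,
      q 2 * q 3, q 2 * q 4]) (i : Fin 8) (j : Fin 6) :
    b i * q j = 0 := by
  have t1 : q 0 * q 2 * q 4 = 0 := by
    linear_combination (-q 4) * g12 + q 5 * g2 + (α : A) * q 2 * g4
  have t2 : q 1 * q 3 * q 5 = 0 := by
    linear_combination q 1 * g12 - (α : A) * q 5 * g10 + q 2 * g8
  have t3 : q 2 * q 3 * q 5 = 0 := by
    linear_combination q 2 * g12 - (α : A) * q 5 * g11 + q 0 * g11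
  have t4 : q 0 * q 2 * q 3 = 0 := by
    linear_combination q 2 * g13 - q 5 * g11 - ((α : A) - 2) * q 0 * g11
  fin_cases i <;> fin_cases j <;> simp [hb'] <;> grind

theorem stmt_14 (k : Type) [Field k] [CharZero k] (α : ℕ) (hα : 2 ≤ α)
    (I : Ideal (MvPolynomial (Fin 6) k))
    (hI : I = Ideal.span
      ({X 3 ^ 2, X 3 * X 4, X 4 ^ 2, X 4 * X 5, X 5 ^ 2, X 5 * X 0, X 0 ^ 2,
        X 0 * X 1, X 1 ^ 2, X 1 * X 2, X 2 ^ 2,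
        X 3 * X 5 + (α : MvPolynomial (Fin 6) k) * (X 5 * X 2) - X 0 * X 2,
        X 5 * X 2 + X 3 * X 0 +
          ((α : MvPolynomial (Fin 6) k) - 2) * (X 0 * X 2)} :
        Set (MvPolynomial (Fin 6) k))) :
    Module.finrank k
        (Submodule.map (Ideal.Quotient.mkₐ k I).toLinearMap
          (homogeneousSubmodule (Fin 6) k 1)) = 6 ∧
    Module.finrank k
        (Submodule.map (Ideal.Quotient.mkₐ k I).toLinearMap
          (homogeneousSubmodule (Fin 6) k 2)) = 8 ∧
    Submodule.map (Ideal.Quotient.mkₐ k I).toLinearMap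
        (homogeneousSubmodule (Fin 6) k 3) = ⊥ := by
  have haux := roos_aux k α I hI _ rfl
  set π := Ideal.Quotient.mkₐ k I with hπ
  let q : Fin 6 → (MvPolynomial (Fin 6) k ⧸ I) := fun i => π (X i)
  have hq : ∀ i, π (X i) = q i := fun _ => rfl
  have hz : ∀ p, π p = 0 ↔ p ∈ I := fun p => Ideal.Quotient.eq_zero_iff_mem
  have hV : Submodule.map π.toLinearMap (homogeneousSubmodule (Fin 6) k 1) =
      Submodule.span k (Set.range q) := by
    rw [homogeneousSubmodule_one_eq_span_X, Submodule.map_span, ← Set.range_comp]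
    rfl
  have hgen : ∀ g ∈ ({X 3 ^ 2, X 3 * X 4, X 4 ^ 2, X 4 * X 5, X 5 ^ 2, X 5 * X 0, X 0 ^ 2,
        X 0 * X 1, X 1 ^ 2, X 1 * X 2, X 2 ^ 2,
        X 3 * X 5 + (α : MvPolynomial (Fin 6) k) * (X 5 * X 2) - X 0 * X 2,
        X 5 * X 2 + X 3 * X 0 +
          ((α : MvPolynomial (Fin 6) k) - 2) * (X 0 * X 2)} :
        Set (MvPolynomial (Fin 6) k)), π g = 0 := by
    intro g hg
    rw [hz, hI]
    exact Ideal.subset_span hg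
  simp only [Set.mem_insert_iff, Set.mem_singleton_iff, forall_eq_or_imp, forall_eq, map_mul,
    map_pow, map_add, map_sub, map_natCast, map_ofNat, hq] at hgen
  obtain ⟨g1, g2, g3, g4, g5, g6, g7, g8, g9, g10, g11, g12, g13⟩ := hgen
  let b : Fin 8 → (MvPolynomial (Fin 6) k ⧸ I) :=
    ![q 0 * q 2, q 5 * q 2, q 0 * q 4, q 1 * q 3, q 1 * q 4, q 1 * q 5, q 2 * q 3, q 2 * q 4]
  have hmem := roos_mem k _ α q g1 g2 g3 g4 g5 g6 g7 g8 g9 g10 g11 g12 g13 b rfl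
  have hV2 : Submodule.map π.toLinearMap (homogeneousSubmodule (Fin 6) k 2) =
      Submodule.span k (Set.range b) := by
    rw [← homogeneousSubmodule_one_pow, Submodule.map_pow, hV, sq, Submodule.span_mul_span]
    apply le_antisymm
    · rw [Submodule.span_le]
      rintro _ ⟨_, ⟨i, rfl⟩, _, ⟨j, rfl⟩, rfl⟩
      exact hmem i j
    · apply Submodule.span_mono
      rintro _ ⟨n, rfl⟩
      have : ∀ i j, q i * q j ∈ Set.range q * Set.range q :=
        fun i j => Set.mul_mem_mul ⟨i, rfl⟩ ⟨j, rfl⟩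
      fin_cases n <;> exact this _ _
  refine ⟨?_, ?_, ?_⟩
  · rw [hV, finrank_span_eq_card]
    · simp
    · rw [Fintype.linearIndependent_iff]
      intro g hg
      have : (∑ i, C (g i) * X i) ∈ I := by
        rw [← hz, ← hg, map_sum]
        refine Finset.sum_congr rfl fun i _ => ?_
        rw [← smul_eq_C_mul, map_smul, hq]
      have h := (haux _ this).2.1
      intro i
      have := h i
      simpa [pderiv_X, Pi.single_apply, Derivation.leibniz] using this
  · rw [hV2, finrank_span_eq_card]
    · simp
    · rw [Fintype.linearIndependent_iff]
      intro g hg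
      have : (C (g 0) * (X 0 * X 2) + C (g 1) * (X 5 * X 2) + C (g 2) * (X 0 * X 4)
          + C (g 3) * (X 1 * X 3) + C (g 4) * (X 1 * X 4) + C (g 5) * (X 1 * X 5)
          + C (g 6) * (X 2 * X 3) + C (g 7) * (X 2 * X 4)) ∈ I := by
        rw [← hz, ← hg]
        simp only [← smul_eq_C_mul, map_add, map_smul, map_mul, hq, Fin.sum_univ_eight]
        rfl
      have h := (haux _ this).2.2
      simp [pderiv_X, Pi.single_apply, Derivation.leibniz] at h
      obtain ⟨h0, h1, h2, h3, h4, h5, h6, h7⟩ := h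
      intro i
      fin_cases i <;> assumption
  · rw [← homogeneousSubmodule_one_pow, pow_succ, Submodule.map_mul, homogeneousSubmodule_one_pow,
      hV2, hV, Submodule.span_mul_span, Submodule.span_eq_bot]
    rintro _ ⟨_, ⟨i, rfl⟩, _, ⟨j, rfl⟩, rfl⟩
    exact roos_triple _ α q g1 g2 g3 g4 g5 g6 g7 g8 g9 g10 g11 g12 g13 b rfl i j
end
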